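/- arXiv:2502.10738 — 2 statements merged into one kernel-verified Lean document; each statement's English description precedes it below -/
import Mathlib

section
/- Let n ≥ 1 and a ∈ L^∞S^{-n}_0. There is a constant C such that for every 0 < l < 1, every positive integer j, every x_0 ∈ ℝⁿ, every Schwartz function u, and all x, z in the cube Q(x_0, l): ∫_{ℝⁿ} |u(y)| |K_j^*(x,y) − K_j^*(z,y)| dy ≤ C 2^j l Mu(x_0). -/
open MeasureTheory Real
open scoped ENNReal NNReal InnerProductSpace BigOperators

noncomputable section

/-- `ℝⁿ` with its Euclidean structure. -/
abbrev Rn (n : ℕ) : Type := EuclideanSpace ℝ (Fin n)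

/-- The Fourier transform `û(ξ) = ∫ e^{-i⟨x,ξ⟩} u(x) dx`. -/
def ft {n : ℕ} (u : Rn n → ℂ) (ξ : Rn n) : ℂ :=
  ∫ x : Rn n, Complex.exp (-(Complex.I * ((⟪x, ξ⟫_ℝ : ℝ) : ℂ))) * u x

/-- The pseudo-differential operator `T_a u(x) = ∫ e^{i⟨x,ξ⟩} a(x,ξ) û(ξ) dξ`. -/
def pdo {n : ℕ} (a : Rn n → Rn n → ℂ) (u : Rn n → ℂ) (x : Rn n) : ℂ :=
  ∫ ξ : Rn n, Complex.exp (Complex.I * ((⟪x, ξ⟫_ℝ : ℝ) : ℂ)) * a x ξ * ft u ξ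

/-- The dual operator `T_a^* u(x) = ∫∫ e^{i⟨x-y,ξ⟩} a(y,ξ) dξ u(y) dy`. -/
def pdoDual {n : ℕ} (a : Rn n → Rn n → ℂ) (u : Rn n → ℂ) (x : Rn n) : ℂ :=
  ∫ y : Rn n,
    (∫ ξ : Rn n, Complex.exp (Complex.I * ((⟪x - y, ξ⟫_ℝ : ℝ) : ℂ)) * a y ξ) * u y

/-- The Hörmander symbol class `S^m_{ϱ,δ}`: `a` is smooth and
`|∂^β_x ∂^α_ξ a(x,ξ)| ≤ C_{α,β} (1+|ξ|²)^{(m-ϱ|α|+δ|β|)/2}`. -/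
def HormClass {n : ℕ} (m ϱ δ : ℝ) (a : Rn n → Rn n → ℂ) : Prop :=
  ContDiff ℝ (⊤ : ℕ∞) (Function.uncurry a) ∧
  ∀ k l : ℕ, ∃ C : ℝ, 0 < C ∧ ∀ x ξ : Rn n,
    ‖iteratedFDeriv ℝ l (fun y : Rn n => iteratedFDeriv ℝ k (fun η : Rn n => a y η) ξ) x‖ ≤
      C * (1 + ‖ξ‖ ^ 2) ^ ((m - ϱ * k + δ * l) / 2)

/-- The rough Hörmander class `L^∞S^m_ϱ`: `a(x,ξ)` is smooth in `ξ`, bounded measurable in `x`,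
and `‖∂^α_ξ a(·,ξ)‖_{L^∞} ≤ C_α (1+|ξ|²)^{(m-ϱ|α|)/2}`. -/
def RoughClass {n : ℕ} (m ϱ : ℝ) (a : Rn n → Rn n → ℂ) : Prop :=
  (∀ x : Rn n, ContDiff ℝ (⊤ : ℕ∞) (a x)) ∧
  (∀ ξ : Rn n, Measurable fun x : Rn n => a x ξ) ∧
  ∀ k : ℕ, ∃ C : ℝ, 0 < C ∧ ∀ ξ : Rn n, ∀ᵐ x : Rn n ∂volume,
    ‖iteratedFDeriv ℝ k (a x) ξ‖ ≤ C * (1 + ‖ξ‖ ^ 2) ^ ((m - ϱ * k) / 2)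

/-- The axis-parallel cube centered at `x₀` with side length `l`. -/
def cube {n : ℕ} (x₀ : Rn n) (l : ℝ) : Set (Rn n) :=
  {y | ∀ i, |y i - x₀ i| ≤ l / 2}

/-- The Hardy–Littlewood maximal function over axis-parallel cubes. -/
def mHL {n : ℕ} {E : Type*} [NormedAddCommGroup E] (u : Rn n → E) (x : Rn n) : ℝ≥0∞ :=
  ⨆ (x₀ : Rn n) (l : ℝ) (_ : 0 < l) (_ : x ∈ cube x₀ l),
    (∫⁻ y in cube x₀ l, (‖u y‖₊ : ℝ≥0∞)) / ENNReal.ofReal (l ^ n)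

/-- The Fefferman–Stein sharp maximal function over axis-parallel cubes. -/
def mSharp {n : ℕ} (u : Rn n → ℂ) (x : Rn n) : ℝ≥0∞ :=
  ⨆ (x₀ : Rn n) (l : ℝ) (_ : 0 < l) (_ : x ∈ cube x₀ l),
    ⨅ c : ℂ, (∫⁻ y in cube x₀ l, (‖u y - c‖₊ : ℝ≥0∞)) / ENNReal.ofReal (l ^ n)

/-- The Muckenhoupt `A₁` condition: `Mω ≤ C ω` a.e. -/
def IsA1 {n : ℕ} (ω : Rn n → ℝ) : Prop :=
  (∀ x, 0 ≤ ω x) ∧ LocallyIntegrable ω volume ∧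
  ∃ C : ℝ, 0 < C ∧ ∀ᵐ x : Rn n ∂volume, mHL ω x ≤ ENNReal.ofReal (C * ω x)

/-- The Muckenhoupt `A_p` condition for `1 < p < ∞`. -/
def IsAp {n : ℕ} (p : ℝ) (ω : Rn n → ℝ) : Prop :=
  (∀ x, 0 ≤ ω x) ∧ LocallyIntegrable ω volume ∧
  ∃ C : ℝ, 0 < C ∧ ∀ (x₀ : Rn n) (l : ℝ), 0 < l →
    ((∫⁻ y in cube x₀ l, ENNReal.ofReal (ω y)) / ENNReal.ofReal (l ^ n)) *
      (((∫⁻ y in cube x₀ l, ENNReal.ofReal (ω y ^ (1 / (1 - p)))) /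
          ENNReal.ofReal (l ^ n)) ^ (p - 1))
      ≤ ENNReal.ofReal C

/-- The weighted measure `ω(s) = ∫_s ω dx`. -/
def wMeas {n : ℕ} (ω : Rn n → ℝ) (s : Set (Rn n)) : ℝ≥0∞ :=
  ∫⁻ x in s, ENNReal.ofReal (ω x)

/-- The weighted `L¹` norm `∫ |u| ω dx`. -/
def wL1 {n : ℕ} (ω : Rn n → ℝ) (u : Rn n → ℂ) : ℝ≥0∞ :=
  ∫⁻ x : Rn n, (‖u x‖₊ : ℝ≥0∞) * ENNReal.ofReal (ω x)

/-- The weighted `L^p` norm `(∫ |u|^p ω dx)^{1/p}`. -/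
def wLp {n : ℕ} (p : ℝ) (ω : Rn n → ℝ) (u : Rn n → ℂ) : ℝ≥0∞ :=
  (∫⁻ x : Rn n, (‖u x‖₊ : ℝ≥0∞) ^ p * ENNReal.ofReal (ω x)) ^ (1 / p)

/-- A Littlewood–Paley cut-off: `ψ ∈ C_c^∞`, `0 ≤ ψ ≤ 1`, supported in the annulus
`{C₀⁻¹ ≤ |ξ| ≤ 2C₀}`. -/
def LPcut {n : ℕ} (C₀ : ℝ) (ψ : Rn n → ℝ) : Prop :=
  ContDiff ℝ (⊤ : ℕ∞) ψ ∧ HasCompactSupport ψ ∧ (∀ ξ, 0 ≤ ψ ξ) ∧ (∀ ξ, ψ ξ ≤ 1) ∧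
  tsupport ψ ⊆ {ξ : Rn n | C₀⁻¹ ≤ ‖ξ‖ ∧ ‖ξ‖ ≤ 2 * C₀}

/-- `K_j(x,y) = (2π)^{-n} ∫ e^{i⟨x-y,ξ⟩} a(x,ξ) ψ(2^{-j}ξ) dξ`. -/
def Kj {n : ℕ} (a : Rn n → Rn n → ℂ) (ψ : Rn n → ℝ) (j : ℕ) (x y : Rn n) : ℂ :=
  ((((2 * π) ^ n)⁻¹ : ℝ) : ℂ) *
    ∫ ξ : Rn n, Complex.exp (Complex.I * ((⟪x - y, ξ⟫_ℝ : ℝ) : ℂ)) * a x ξ *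
      ((ψ ((((2 : ℝ) ^ j)⁻¹) • ξ) : ℝ) : ℂ)

/-- `K_j^*(x,y) = (2π)^{-n} ∫ e^{i⟨x-y,ξ⟩} a(y,ξ) ψ(2^{-j}ξ) dξ`. -/
def KjStar {n : ℕ} (a : Rn n → Rn n → ℂ) (ψ : Rn n → ℝ) (j : ℕ) (x y : Rn n) : ℂ :=
  ((((2 * π) ^ n)⁻¹ : ℝ) : ℂ) *
    ∫ ξ : Rn n, Complex.exp (Complex.I * ((⟪x - y, ξ⟫_ℝ : ℝ) : ℂ)) * a y ξ *
      ((ψ ((((2 : ℝ) ^ j)⁻¹) • ξ) : ℝ) : ℂ)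

/-- `T_j u(x) = ∫ K_j(x,y) u(y) dy`. -/
def Tj {n : ℕ} (a : Rn n → Rn n → ℂ) (ψ : Rn n → ℝ) (j : ℕ) (u : Rn n → ℂ) (x : Rn n) : ℂ :=
  ∫ y : Rn n, Kj a ψ j x y * u y

/-- `T_j^* u(x) = ∫ K_j^*(x,y) u(y) dy`. -/
def TjStar {n : ℕ} (a : Rn n → Rn n → ℂ) (ψ : Rn n → ℝ) (j : ℕ) (u : Rn n → ℂ) (x : Rn n) : ℂ :=
  ∫ y : Rn n, KjStar a ψ j x y * u y

/-- The Fourier integral operator `T_{a,φ} u(x) = ∫ e^{iφ(x,ξ)} a(x,ξ) û(ξ) dξ`. -/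
def fio {n : ℕ} (a : Rn n → Rn n → ℂ) (φ : Rn n → Rn n → ℝ) (u : Rn n → ℂ) (x : Rn n) : ℂ :=
  ∫ ξ : Rn n, Complex.exp (Complex.I * ((φ x ξ : ℝ) : ℂ)) * a x ξ * ft u ξ

/-- The dual FIO `T^*_{a,φ} u(x) = ∫∫ e^{i(φ(y,ξ)-⟨x,ξ⟩)} a(y,ξ) dξ u(y) dy`. -/
def fioDual {n : ℕ} (a : Rn n → Rn n → ℂ) (φ : Rn n → Rn n → ℝ) (u : Rn n → ℂ) (x : Rn n) : ℂ :=
  ∫ y : Rn n,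
    (∫ ξ : Rn n, Complex.exp (Complex.I * ((φ y ξ - ⟪x, ξ⟫_ℝ : ℝ) : ℂ)) * a y ξ) * u y

/-- The phase class `Φ¹`: smooth on `ℝⁿ × (ℝⁿ∖{0})`, positively homogeneous of degree 1 in `ξ`,
with `sup |ξ|^{-1+|α|} |∂^α_ξ ∂^β_x φ| ≤ C_{α,β}` for `|α|+|β| ≥ 1`. -/
def Phi1 {n : ℕ} (φ : Rn n → Rn n → ℝ) : Prop :=
  ContDiffOn ℝ (⊤ : ℕ∞) (Function.uncurry φ) {p : Rn n × Rn n | p.2 ≠ 0} ∧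
  (∀ x : Rn n, ∀ ξ : Rn n, ξ ≠ 0 → ∀ t : ℝ, 0 < t → φ x (t • ξ) = t * φ x ξ) ∧
  ∀ k l : ℕ, 1 ≤ k + l → ∃ C : ℝ, 0 < C ∧ ∀ x ξ : Rn n, ξ ≠ 0 →
    ‖ξ‖ ^ ((k : ℝ) - 1) *
        ‖iteratedFDeriv ℝ k (fun η : Rn n => iteratedFDeriv ℝ l (fun y : Rn n => φ y η) x) ξ‖
      ≤ C

/-- The rough phase class `L^∞Φ¹`: positively homogeneous of degree 1 in `ξ`, smooth in `ξ` away
from the origin, bounded measurable in `x`, with `sup |ξ|^{-1+|α|} ‖∂^α_ξ φ(·,ξ)‖_{L^∞} ≤ C_α`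
for `|α| ≥ 1`. -/
def LinfPhi1 {n : ℕ} (φ : Rn n → Rn n → ℝ) : Prop :=
  (∀ x : Rn n, ContDiffOn ℝ (⊤ : ℕ∞) (φ x) {ξ : Rn n | ξ ≠ 0}) ∧
  (∀ ξ : Rn n, Measurable fun x : Rn n => φ x ξ) ∧
  (∀ ξ : Rn n, ∃ C : ℝ, ∀ x : Rn n, |φ x ξ| ≤ C) ∧
  (∀ x : Rn n, ∀ ξ : Rn n, ξ ≠ 0 → ∀ t : ℝ, 0 < t → φ x (t • ξ) = t * φ x ξ) ∧
  ∀ k : ℕ, 1 ≤ k → ∃ C : ℝ, 0 < C ∧ ∀ ξ : Rn n, ξ ≠ 0 → ∀ᵐ x : Rn n ∂volume,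
    ‖ξ‖ ^ ((k : ℝ) - 1) * ‖iteratedFDeriv ℝ k (φ x) ξ‖ ≤ C

theorem iteratedDeriv_cexp_I_mul_ofReal (k : ℕ) :
    iteratedDeriv k (fun t : ℝ => Complex.exp (Complex.I * (t : ℂ))) =
      fun t : ℝ => Complex.I ^ k * Complex.exp (Complex.I * (t : ℂ)) := by
  induction k with
  | zero => simp
  | succ k ih =>
    rw [iteratedDeriv_succ, ih]
    funext t
    have h : HasDerivAt (fun t : ℝ => Complex.exp (Complex.I * (t : ℂ)))
        (Complex.exp (Complex.I * (t : ℂ)) * (Complex.I * 1)) t :=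
      ((Complex.ofRealCLM.hasDerivAt (x := t)).const_mul Complex.I).cexp
    rw [(h.const_mul (Complex.I ^ k)).deriv]
    ring

theorem contDiff_cexp_I_mul_inner {n : ℕ} (p : Rn n) {N : WithTop ℕ∞} :
    ContDiff ℝ N (fun ξ : Rn n => Complex.exp (Complex.I * ((⟪p, ξ⟫_ℝ : ℝ) : ℂ))) := by
  have h : ContDiff ℝ N (fun ξ : Rn n => ((⟪p, ξ⟫_ℝ : ℝ) : ℂ)) :=
    Complex.ofRealCLM.contDiff.comp (contDiff_const.inner ℝ contDiff_id)
  exact (contDiff_const.mul h).cexp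

theorem norm_iteratedFDeriv_cexp_I_mul_inner_le {n : ℕ} (p ξ : Rn n) (k : ℕ) :
    ‖iteratedFDeriv ℝ k (fun ξ : Rn n => Complex.exp (Complex.I * ((⟪p, ξ⟫_ℝ : ℝ) : ℂ))) ξ‖ ≤
      ‖p‖ ^ k := by
  have hc : ContDiff ℝ k (fun t : ℝ => Complex.exp (Complex.I * (t : ℂ))) :=
    (contDiff_const.mul Complex.ofRealCLM.contDiff).cexp
  have h := (innerSL ℝ p).iteratedFDeriv_comp_right hc ξ (i := k) le_rfl
  change ‖iteratedFDeriv ℝ k ((fun t : ℝ => Complex.exp (Complex.I * (t : ℂ))) ∘ innerSL ℝ p) ξ‖ ≤ _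
  rw [h]
  refine (ContinuousMultilinearMap.norm_compContinuousLinearMap_le _ _).trans ?_
  rw [norm_iteratedFDeriv_eq_norm_iteratedDeriv, iteratedDeriv_cexp_I_mul_ofReal]
  simp [Complex.norm_exp_I_mul_ofReal]

theorem norm_iteratedFDeriv_mul_le_of_le {n : ℕ} {f g : Rn n → ℂ} {k : ℕ}
    (hf : ContDiff ℝ k f) (hg : ContDiff ℝ k g) {ξ : Rn n} {A B : ℝ} (hA : 0 ≤ A)
    (hfA : ∀ i ≤ k, ‖iteratedFDeriv ℝ i f ξ‖ ≤ A) (hgB : ∀ i ≤ k, ‖iteratedFDeriv ℝ i g ξ‖ ≤ B) :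
    ‖iteratedFDeriv ℝ k (fun η => f η * g η) ξ‖ ≤ 2 ^ k * (A * B) := by
  refine (norm_iteratedFDeriv_mul_le hf hg ξ le_rfl).trans ?_
  calc _ ≤ ∑ i ∈ Finset.range (k + 1), (k.choose i : ℝ) * (A * B) := by
        refine Finset.sum_le_sum fun i hi => ?_
        rw [mul_assoc]
        gcongr
        · exact hfA i (by simpa [Nat.lt_succ_iff] using hi)
        · exact hgB _ (Nat.sub_le _ _)
    _ = _ := by
        rw [← Finset.sum_mul]
        congr 1
        exact_mod_cast Nat.sum_range_choose k

/-- Decay of an oscillatory integral from bounds on the derivatives of its amplitude. -/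
theorem norm_integral_cexp_mul_le {n : ℕ} (N : ℕ) {g : Rn n → ℂ} (hg : ContDiff ℝ (⊤ : ℕ∞) g)
    {R D : ℝ} (hR : 0 ≤ R) (hsupp : tsupport g ⊆ Metric.closedBall 0 R)
    (hbd : ∀ k ≤ N, ∀ ξ, ‖iteratedFDeriv ℝ k g ξ‖ ≤ D) (w : Rn n) :
    ‖∫ ξ : Rn n, Complex.exp (Complex.I * ((⟪w, ξ⟫_ℝ : ℝ) : ℂ)) * g ξ‖ * ‖w‖ ^ N ≤
      (4 * π) ^ N * ((N + 1) * (D * (R ^ n * volume.real (Metric.ball (0 : Rn n) 1)))) := by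
  have hcs : HasCompactSupport g :=
    HasCompactSupport.of_support_subset_isCompact (isCompact_closedBall 0 R)
      ((subset_tsupport g).trans hsupp)
  have hft : ∫ ξ : Rn n, Complex.exp (Complex.I * ((⟪w, ξ⟫_ℝ : ℝ) : ℂ)) * g ξ =
      FourierTransform.fourier g (-(2 * π)⁻¹ • w) := by
    rw [Real.fourier_eq']
    refine integral_congr_ae (Filter.Eventually.of_forall fun ξ => ?_)
    have : (-2 * π * ⟪ξ, -(2 * π)⁻¹ • w⟫_ℝ) = ⟪w, ξ⟫_ℝ := by
      rw [inner_smul_right, real_inner_comm]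
      field_simp
    simp only [this, smul_eq_mul]
    rw [mul_comm Complex.I]
  have hcont : ∀ k : ℕ, Continuous fun ξ => iteratedFDeriv ℝ k g ξ := fun k =>
    hg.continuous_iteratedFDeriv (by exact_mod_cast le_top)
  have hint : ∀ k m : ℕ, (k : ℕ∞) ≤ 0 → (m : ℕ∞) ≤ ⊤ →
      Integrable (fun v => ‖v‖ ^ k * ‖iteratedFDeriv ℝ m g v‖) := fun k m _ _ =>
    Continuous.integrable_of_hasCompactSupport
      ((continuous_norm.pow k).mul (hcont m).norm) ((hcs.iteratedFDeriv m).norm.mul_left)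
  have key := pow_mul_norm_iteratedFDeriv_fourier_le (K := 0) (N := ⊤) (f := g) (by exact_mod_cast hg)
    hint (k := 0) (n := N) (by simp) le_top (-(2 * π)⁻¹ • w)
  have hI : ∀ k ≤ N, ∫ v, ‖iteratedFDeriv ℝ k g v‖ ≤
      D * (R ^ n * volume.real (Metric.ball (0 : Rn n) 1)) := by
    intro k hk
    have h1 : ∫ v, ‖iteratedFDeriv ℝ k g v‖ =
        ∫ v in Metric.closedBall (0 : Rn n) R, ‖iteratedFDeriv ℝ k g v‖ := by
      refine (setIntegral_eq_integral_of_forall_compl_eq_zero fun v hv => ?_).symm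
      rw [norm_eq_zero]
      by_contra h
      exact hv (hsupp (support_iteratedFDeriv_subset k h))
    rw [h1]
    have h2 := norm_setIntegral_le_of_norm_le_const (μ := volume)
      (s := Metric.closedBall (0 : Rn n) R) (f := fun v => ‖iteratedFDeriv ℝ k g v‖) (C := D)
      measure_closedBall_lt_top (fun v _ => by simpa using hbd k hk v)
    rw [Measure.addHaar_real_closedBall _ _ hR, finrank_euclideanSpace_fin] at h2
    exact (le_abs_self _).trans h2
  have hsum : ∑ p ∈ Finset.range (0 + 1) ×ˢ Finset.range (N + 1),
      ∫ v, ‖v‖ ^ p.1 * ‖iteratedFDeriv ℝ p.2 g v‖ ≤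
      (N + 1) * (D * (R ^ n * volume.real (Metric.ball (0 : Rn n) 1))) := by
    refine (Finset.sum_le_card_nsmul _ _
      (D * (R ^ n * volume.real (Metric.ball (0 : Rn n) 1))) ?_).trans (le_of_eq ?_)
    · rintro ⟨p, q⟩ hpq
      simp only [zero_add, Finset.range_one, Finset.mem_product, Finset.mem_singleton,
        Finset.mem_range, Nat.lt_succ_iff] at hpq
      obtain ⟨rfl, hq⟩ := hpq
      simpa using hI q hq
    · simp
  rw [hft]
  have key2 := key.trans (mul_le_mul_of_nonneg_left hsum (by positivity))
  rw [norm_iteratedFDeriv_zero, norm_smul, norm_neg, norm_inv, Real.norm_of_nonneg (by positivity),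
    mul_pow, inv_pow] at key2
  have h4 : (4 * π) ^ N = (2 * π) ^ N * 2 ^ N := by rw [← mul_pow]; ring
  rw [h4]
  simp only [pow_zero, one_mul, Nat.cast_zero, mul_zero, zero_add] at key2
  calc _ = (2 * π) ^ N * (((2 * π) ^ N)⁻¹ * ‖w‖ ^ N *
        ‖FourierTransform.fourier g (-(2 * π)⁻¹ • w)‖) := by
        field_simp
    _ ≤ _ := by
        rw [mul_assoc ((2 * π) ^ N)]
        gcongr

theorem norm_integral_cexp_mul_le_div {n : ℕ} (N : ℕ) {g : Rn n → ℂ}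
    (hg : ContDiff ℝ (⊤ : ℕ∞) g)
    {R D : ℝ} (hR : 0 ≤ R) (hD : 0 ≤ D) (hsupp : tsupport g ⊆ Metric.closedBall 0 R)
    (hbd : ∀ k ≤ N, ∀ ξ, ‖iteratedFDeriv ℝ k g ξ‖ ≤ D) (w : Rn n) :
    ‖∫ ξ : Rn n, Complex.exp (Complex.I * ((⟪w, ξ⟫_ℝ : ℝ) : ℂ)) * g ξ‖ ≤
      2 ^ N * (4 * π) ^ N * (N + 1) * volume.real (Metric.ball (0 : Rn n) 1) * (D * R ^ n) *
        ((1 + ‖w‖) ^ N)⁻¹ := by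
  have h0 := norm_integral_cexp_mul_le 0 hg hR hsupp
    (fun k hk => hbd k (hk.trans (Nat.zero_le N))) w
  have hN := norm_integral_cexp_mul_le N hg hR hsupp hbd w
  set J := ‖∫ ξ : Rn n, Complex.exp (Complex.I * ((⟪w, ξ⟫_ℝ : ℝ) : ℂ)) * g ξ‖
  set V := volume.real (Metric.ball (0 : Rn n) 1)
  have hV : 0 ≤ V := measureReal_nonneg
  have hJ : 0 ≤ J := norm_nonneg _
  have hpi : 1 ≤ (4 * π) ^ N := one_le_pow₀ (by linarith [Real.pi_gt_three])
  have hJ1 : J ≤ (4 * π) ^ N * ((N + 1) * (D * (R ^ n * V))) := by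
    have h1 : 1 * (1 * (D * (R ^ n * V))) ≤ (4 * π) ^ N * ((N + 1) * (D * (R ^ n * V))) := by
      gcongr
      simp
    simp only [pow_zero, mul_one, Nat.cast_zero, zero_add, one_mul] at h0 h1
    exact h0.trans h1
  rw [← div_eq_mul_inv, le_div_iff₀ (by positivity)]
  have : (1 + ‖w‖) ^ N ≤ 2 ^ N * max 1 (‖w‖ ^ N) := by
    rcases le_total ‖w‖ 1 with h | h
    · calc (1 + ‖w‖) ^ N ≤ 2 ^ N := by gcongr; linarith
        _ ≤ _ := le_mul_of_one_le_right (by positivity) (le_max_left _ _)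
    · calc (1 + ‖w‖) ^ N ≤ (2 * ‖w‖) ^ N := by gcongr; linarith
        _ = 2 ^ N * ‖w‖ ^ N := mul_pow _ _ _
        _ ≤ _ := by gcongr; exact le_max_right _ _
  calc J * (1 + ‖w‖) ^ N ≤ J * (2 ^ N * max 1 (‖w‖ ^ N)) := by gcongr
    _ = 2 ^ N * (J * max 1 (‖w‖ ^ N)) := by ring
    _ ≤ 2 ^ N * ((4 * π) ^ N * ((N + 1) * (D * (R ^ n * V)))) := by
        refine mul_le_mul_of_nonneg_left ?_ (by positivity)
        rcases max_choice 1 (‖w‖ ^ N) with h | h <;> rw [h]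
        · simpa using hJ1
        · exact hN
    _ = _ := by ring

theorem norm_sub_le_of_mem_cube {n : ℕ} {x₀ x : Rn n} {l : ℝ} (hl : 0 ≤ l)
    (hx : x ∈ cube x₀ l) : ‖x - x₀‖ ≤ n * l := by
  have h : ‖x - x₀‖ ≤ ∑ i, ‖(x - x₀) i‖ := by
    rw [EuclideanSpace.norm_eq]
    refine Real.sqrt_le_iff.2 ⟨by positivity, ?_⟩
    exact Finset.sum_sq_le_sq_sum_of_nonneg fun i _ => norm_nonneg _
  refine h.trans ((Finset.sum_le_card_nsmul _ _ l fun i _ => ?_).trans (by simp))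
  have := hx i
  simp only [PiLp.sub_apply, Real.norm_eq_abs]
  linarith

theorem norm_iteratedFDeriv_cexp_sub_cexp_le {n : ℕ} (N : ℕ) {p q : Rn n} {l R : ℝ}
    (hl : 0 ≤ l) (hl1 : l ≤ 1) (hR : 1 ≤ R) {A : ℝ} (hA : 1 ≤ A)
    (hp : ‖p‖ ≤ A * l) (hq : ‖q‖ ≤ A * l)
    {ξ : Rn n} (hξ : ‖ξ‖ ≤ R) {k : ℕ} (hk : k ≤ N) :
    ‖iteratedFDeriv ℝ k (fun ξ : Rn n => Complex.exp (Complex.I * ((⟪p, ξ⟫_ℝ : ℝ) : ℂ)) -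
      Complex.exp (Complex.I * ((⟪q, ξ⟫_ℝ : ℝ) : ℂ))) ξ‖ ≤ 2 * A ^ (N + 1) * l * R := by
  have hb : A * l ≤ A ^ (N + 1) * l := by gcongr; exact le_self_pow₀ hA (by omega)
  rcases Nat.eq_zero_or_pos k with rfl | hk0
  · rw [norm_iteratedFDeriv_zero]
    have e : Complex.exp (Complex.I * ((⟪p, ξ⟫_ℝ : ℝ) : ℂ)) -
      Complex.exp (Complex.I * ((⟪q, ξ⟫_ℝ : ℝ) : ℂ)) =
        Complex.exp (Complex.I * ((⟪q, ξ⟫_ℝ : ℝ) : ℂ)) *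
          (Complex.exp (Complex.I * ((⟪p - q, ξ⟫_ℝ : ℝ) : ℂ)) - 1) := by
      rw [mul_sub, ← Complex.exp_add, inner_sub_left]
      push_cast
      ring_nf
    rw [e, norm_mul, Complex.norm_exp_I_mul_ofReal, one_mul]
    refine Real.norm_exp_I_mul_ofReal_sub_one_le.trans ((norm_inner_le_norm _ _).trans ?_)
    have : ‖p - q‖ ≤ 2 * A ^ (N + 1) * l := by linarith [norm_sub_le p q]
    gcongr
  · have hpow : ∀ r : Rn n, ‖r‖ ≤ A * l → ‖r‖ ^ k ≤ A ^ (N + 1) * l := by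
      intro r hr
      calc ‖r‖ ^ k ≤ (A * l) ^ k := by gcongr
        _ = A ^ k * l ^ k := mul_pow _ _ _
        _ ≤ A ^ (N + 1) * l := by
          gcongr
          · omega
          · exact pow_le_of_le_one hl hl1 hk0.ne'
    rw [fun_iteratedFDeriv_sub_apply (contDiff_cexp_I_mul_inner p).contDiffAt
      (contDiff_cexp_I_mul_inner q).contDiffAt]
    refine (norm_sub_le _ _).trans ?_
    have h1 := (norm_iteratedFDeriv_cexp_I_mul_inner_le p ξ k).trans (hpow p hp)
    have h2 := (norm_iteratedFDeriv_cexp_I_mul_inner_le q ξ k).trans (hpow q hq)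
    have h3 : 2 * A ^ (N + 1) * l ≤ 2 * A ^ (N + 1) * l * R :=
      le_mul_of_one_le_right (by positivity) hR
    linarith

theorem RoughClass.ae_forall {n : ℕ} {m ϱ : ℝ} {a : Rn n → Rn n → ℂ} (ha : RoughClass m ϱ a)
    (k : ℕ) : ∃ C : ℝ, 0 < C ∧ ∀ᵐ x : Rn n, ∀ ξ : Rn n,
      ‖iteratedFDeriv ℝ k (a x) ξ‖ ≤ C * (1 + ‖ξ‖ ^ 2) ^ ((m - ϱ * k) / 2) := by
  obtain ⟨C, hC, h⟩ := ha.2.2 k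
  refine ⟨C, hC, ?_⟩
  have h' := ae_all_iff.2 fun i : ℕ => h (TopologicalSpace.denseSeq (Rn n) i)
  filter_upwards [h'] with x hx ξ
  refine (TopologicalSpace.denseRange_denseSeq (Rn n)).induction_on ξ (isClosed_le ?_ ?_) hx
  · exact ((ha.1 x).continuous_iteratedFDeriv (by exact_mod_cast le_top)).norm
  · exact continuous_const.mul ((by fun_prop : Continuous fun ξ : Rn n => 1 + ‖ξ‖ ^ 2).rpow_const
      fun ξ => Or.inl (by positivity))

theorem RoughClass.ae_forall_le {n : ℕ} {m : ℝ} {a : Rn n → Rn n → ℂ} (ha : RoughClass m 0 a)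
    (N : ℕ) : ∃ C : ℝ, 0 < C ∧ ∀ᵐ x : Rn n, ∀ k ≤ N, ∀ ξ : Rn n,
      ‖iteratedFDeriv ℝ k (a x) ξ‖ ≤ C * (1 + ‖ξ‖ ^ 2) ^ (m / 2) := by
  choose C hC h using fun k => ha.ae_forall k
  refine ⟨∑ k ∈ Finset.range (N + 1), C k, Finset.sum_pos (fun k _ => hC k) (by simp), ?_⟩
  filter_upwards [ae_all_iff.2 h] with x hx k hk ξ
  refine (hx k ξ).trans ?_
  rw [zero_mul, sub_zero]
  gcongr
  exact Finset.single_le_sum (f := C) (fun i _ => (hC i).le) (by simpa [Nat.lt_succ_iff] using hk)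

theorem lintegral_mul_weight_le_mHL {n : ℕ} (u : Rn n → ℂ) (hu : Measurable u) (x₀ : Rn n) :
    ∫⁻ y, (‖u y‖₊ : ℝ≥0∞) * ENNReal.ofReal (((1 + ‖x₀ - y‖) ^ (n + 1))⁻¹) ≤
      ENNReal.ofReal (2 * 4 ^ n) * mHL u x₀ := by
  have hmeas : ∀ l : ℝ, MeasurableSet (cube x₀ l) := fun l => by
    have : cube x₀ l = ⋂ i, {y : Rn n | |y i - x₀ i| ≤ l / 2} := by
      ext y
      simp [cube]
    rw [this]
    exact MeasurableSet.iInter fun i => (isClosed_le (by fun_prop) continuous_const).measurableSet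
  have hM : ∀ l : ℝ, 0 < l →
      ∫⁻ y in cube x₀ l, (‖u y‖₊ : ℝ≥0∞) ≤ ENNReal.ofReal (l ^ n) * mHL u x₀ := by
    intro l hl
    have h : (∫⁻ y in cube x₀ l, (‖u y‖₊ : ℝ≥0∞)) / ENNReal.ofReal (l ^ n) ≤ mHL u x₀ :=
      le_iSup₂_of_le x₀ l (le_iSup₂_of_le hl (by intro i; simp; positivity) le_rfl)
    have hpos : ENNReal.ofReal (l ^ n) ≠ 0 := by simpa using pow_pos hl n
    rwa [ENNReal.div_le_iff hpos ENNReal.ofReal_ne_top, mul_comm] at h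
  have hw : ∀ y, (‖u y‖₊ : ℝ≥0∞) * ENNReal.ofReal (((1 + ‖x₀ - y‖) ^ (n + 1))⁻¹) ≤
      ∑' k : ℕ, ENNReal.ofReal (((2 : ℝ) ^ (k * (n + 1)))⁻¹) *
        (cube x₀ (2 ^ (k + 2))).indicator (fun y => (‖u y‖₊ : ℝ≥0∞)) y := by
    intro y
    obtain ⟨k, hk1, hk2⟩ := exists_nat_pow_near (x := 1 + ‖x₀ - y‖) (y := (2 : ℝ))
      (by linarith [norm_nonneg (x₀ - y)]) one_lt_two
    refine le_trans ?_ (ENNReal.le_tsum k)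
    have hy : y ∈ cube x₀ (2 ^ (k + 2)) := by
      intro i
      have h1 : ‖(x₀ - y) i‖ ≤ ‖x₀ - y‖ := PiLp.norm_apply_le _ _
      rw [PiLp.sub_apply, Real.norm_eq_abs, abs_sub_comm] at h1
      have h2 : (2 : ℝ) ^ (k + 2) / 2 = 2 ^ (k + 1) := by ring
      linarith
    rw [Set.indicator_of_mem hy, mul_comm, pow_mul]
    gcongr
  have hterm : ∀ k : ℕ, ∫⁻ y, ENNReal.ofReal (((2 : ℝ) ^ (k * (n + 1)))⁻¹) *
        (cube x₀ (2 ^ (k + 2))).indicator (fun y => (‖u y‖₊ : ℝ≥0∞)) y ≤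
      ENNReal.ofReal (4 ^ n * (1 / 2) ^ k) * mHL u x₀ := by
    intro k
    rw [lintegral_const_mul _ (hu.nnnorm.coe_nnreal_ennreal.indicator (hmeas _)),
      lintegral_indicator (hmeas _)]
    refine (mul_le_mul_right (hM (2 ^ (k + 2)) (by positivity)) _).trans (le_of_eq ?_)
    rw [← mul_assoc, ← ENNReal.ofReal_mul (by positivity)]
    congr 2
    have : ((2 : ℝ) ^ (k + 2)) ^ n = 2 ^ (k * n) * 4 ^ n := by
      rw [← pow_mul, add_mul, pow_add, mul_comm 2 n, mul_comm n 2, pow_mul 2 2 n]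
      norm_num
    rw [this, mul_add, pow_add, mul_one, one_div, inv_pow]
    field_simp
  calc _ ≤ ∫⁻ y, ∑' k : ℕ, ENNReal.ofReal (((2 : ℝ) ^ (k * (n + 1)))⁻¹) *
        (cube x₀ (2 ^ (k + 2))).indicator (fun y => (‖u y‖₊ : ℝ≥0∞)) y := lintegral_mono hw
    _ = ∑' k : ℕ, ∫⁻ y, ENNReal.ofReal (((2 : ℝ) ^ (k * (n + 1)))⁻¹) *
        (cube x₀ (2 ^ (k + 2))).indicator (fun y => (‖u y‖₊ : ℝ≥0∞)) y :=
      lintegral_tsum fun k => ((hu.nnnorm.coe_nnreal_ennreal.indicator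
        (hmeas _)).const_mul _).aemeasurable
    _ ≤ ∑' k : ℕ, ENNReal.ofReal (4 ^ n * (1 / 2) ^ k) * mHL u x₀ := ENNReal.tsum_le_tsum hterm
    _ = _ := by
      rw [ENNReal.tsum_mul_right, ← ENNReal.ofReal_tsum_of_nonneg (fun k => by positivity)
        (summable_geometric_two.mul_left _), tsum_mul_left, tsum_geometric_two, mul_comm (4 ^ n)]

theorem exists_norm_iteratedFDeriv_dilate_le {n : ℕ} {ψ : Rn n → ℝ}
    (hψ : ContDiff ℝ (⊤ : ℕ∞) ψ) (hc : HasCompactSupport ψ) (N : ℕ) :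
    ∃ M : ℝ, 0 ≤ M ∧ ∀ t : ℝ, |t| ≤ 1 → ∀ k ≤ N, ∀ ξ : Rn n,
      ‖iteratedFDeriv ℝ k (fun ξ => ((ψ (t • ξ) : ℝ) : ℂ)) ξ‖ ≤ M := by
  have hb : ∀ k : ℕ, ∃ M : ℝ, ∀ ξ, ‖iteratedFDeriv ℝ k ψ ξ‖ ≤ M := fun k =>
    (hc.iteratedFDeriv k).exists_bound_of_continuous
      (hψ.continuous_iteratedFDeriv (by exact_mod_cast le_top))
  choose M hM using hb
  have hM0 : ∀ k, 0 ≤ M k := fun k => (norm_nonneg _).trans (hM k 0)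
  refine ⟨∑ k ∈ Finset.range (N + 1), M k, Finset.sum_nonneg fun k _ => hM0 k, ?_⟩
  intro t ht k hk ξ
  have hψk : ContDiff ℝ k ψ := hψ.of_le (by exact_mod_cast le_top)
  have hcomp : ContDiff ℝ k fun ξ => ψ (t • ξ) := hψk.comp (contDiff_const_smul t)
  have h1 : ‖iteratedFDeriv ℝ k (fun ξ => ((ψ (t • ξ) : ℝ) : ℂ)) ξ‖ =
      ‖iteratedFDeriv ℝ k (fun ξ => ψ (t • ξ)) ξ‖ :=
    Complex.ofRealLI.norm_iteratedFDeriv_comp_left hcomp.contDiffAt le_rfl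
  rw [h1, iteratedFDeriv_comp_const_smul t hψk, norm_smul, norm_pow, Real.norm_eq_abs]
  calc |t| ^ k * ‖iteratedFDeriv ℝ k ψ (t • ξ)‖ ≤ 1 * M k :=
        mul_le_mul (pow_le_one₀ (abs_nonneg t) ht) (hM k _) (norm_nonneg _) zero_le_one
    _ ≤ _ := by
        rw [one_mul]
        exact Finset.single_le_sum (f := M) (fun i _ => hM0 i) (by simpa [Nat.lt_succ_iff] using hk)

theorem KjStar_sub_KjStar {n : ℕ} {a : Rn n → Rn n → ℂ} {ψ : Rn n → ℝ} {j : ℕ} {y : Rn n}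
    (hcont : Continuous fun ξ => a y ξ * ((ψ ((((2 : ℝ) ^ j)⁻¹) • ξ) : ℝ) : ℂ))
    (hsupp : HasCompactSupport fun ξ => a y ξ * ((ψ ((((2 : ℝ) ^ j)⁻¹) • ξ) : ℝ) : ℂ))
    (x z x₀ : Rn n) :
    KjStar a ψ j x y - KjStar a ψ j z y = ((((2 * π) ^ n)⁻¹ : ℝ) : ℂ) *
      ∫ ξ : Rn n, Complex.exp (Complex.I * ((⟪x₀ - y, ξ⟫_ℝ : ℝ) : ℂ)) *
        ((Complex.exp (Complex.I * ((⟪x - x₀, ξ⟫_ℝ : ℝ) : ℂ)) -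
          Complex.exp (Complex.I * ((⟪z - x₀, ξ⟫_ℝ : ℝ) : ℂ))) *
          (a y ξ * ((ψ ((((2 : ℝ) ^ j)⁻¹) • ξ) : ℝ) : ℂ))) := by
  have hint : ∀ w : Rn n, Integrable fun ξ =>
      Complex.exp (Complex.I * ((⟪w - y, ξ⟫_ℝ : ℝ) : ℂ)) * a y ξ *
        ((ψ ((((2 : ℝ) ^ j)⁻¹) • ξ) : ℝ) : ℂ) := fun w => by
    simp_rw [mul_assoc (Complex.exp _)]
    exact ((contDiff_cexp_I_mul_inner (N := 0) _).continuous.mul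
      hcont).integrable_of_hasCompactSupport hsupp.mul_left
  rw [KjStar, KjStar, ← mul_sub, ← integral_sub (hint x) (hint z)]
  congr 1
  refine integral_congr_ae (Filter.Eventually.of_forall fun ξ => ?_)
  have h : ∀ w : Rn n, Complex.exp (Complex.I * ((⟪w - y, ξ⟫_ℝ : ℝ) : ℂ)) =
      Complex.exp (Complex.I * ((⟪x₀ - y, ξ⟫_ℝ : ℝ) : ℂ)) *
        Complex.exp (Complex.I * ((⟪w - x₀, ξ⟫_ℝ : ℝ) : ℂ)) := fun w => by
    rw [← Complex.exp_add, ← mul_add, ← Complex.ofReal_add, ← inner_add_left]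
    congr 5
    abel
  simp only [h x, h z]
  ring

theorem exists_norm_KjStar_sub_le {n : ℕ} (hn : 1 ≤ n) {a : Rn n → Rn n → ℂ}
    (ha : RoughClass (-(n : ℝ)) 0 a) {C₀ : ℝ} (hC₀ : 1 < C₀) {ψ : Rn n → ℝ} (hψ : LPcut C₀ ψ)
    (N : ℕ) :
    ∃ C : ℝ, 0 ≤ C ∧ ∀ᵐ y : Rn n, ∀ l : ℝ, 0 < l → l < 1 → ∀ j : ℕ, ∀ x₀ : Rn n,
      ∀ x ∈ cube x₀ l, ∀ z ∈ cube x₀ l,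
        ‖KjStar a ψ j x y - KjStar a ψ j z y‖ ≤ C * 2 ^ j * l * ((1 + ‖x₀ - y‖) ^ N)⁻¹ := by
  obtain ⟨hψs, hψc, -, -, hψt⟩ := hψ
  obtain ⟨B, hB, haB⟩ := ha.ae_forall_le N
  obtain ⟨M, hM, hψM⟩ := exists_norm_iteratedFDeriv_dilate_le hψs hψc N
  set V := volume.real (Metric.ball (0 : Rn n) 1)
  have hV : 0 ≤ V := measureReal_nonneg
  have hC₀' : 0 < C₀ := by linarith
  refine ⟨((2 * π) ^ n)⁻¹ * (2 ^ N * (4 * π) ^ N * (N + 1) * V *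
    (2 ^ N * (2 * (n : ℝ) ^ (N + 1) * (2 * C₀) * (2 ^ N * (B * M))) * (2 * C₀ ^ 2) ^ n)),
    by positivity, ?_⟩
  filter_upwards [haB] with y hy l hl hl1 j x₀ x hx z hz
  have h2j : (1 : ℝ) ≤ 2 ^ j := one_le_pow₀ one_le_two
  set t : ℝ := ((2 : ℝ) ^ j)⁻¹ with ht
  have ht0 : 0 < t := by positivity
  have ht1 : |t| ≤ 1 := by rw [abs_of_pos ht0]; exact inv_le_one_of_one_le₀ h2j
  set r : ℝ := C₀⁻¹ * 2 ^ j with hr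
  have hr0 : 0 < r := by positivity
  set R : ℝ := 2 * C₀ * 2 ^ j with hR
  have hR1 : 1 ≤ R := by nlinarith
  set b : Rn n → ℂ := fun ξ => a y ξ * ((ψ (t • ξ) : ℝ) : ℂ) with hb
  set E : Rn n → ℂ := fun ξ => Complex.exp (Complex.I * ((⟪x - x₀, ξ⟫_ℝ : ℝ) : ℂ)) -
    Complex.exp (Complex.I * ((⟪z - x₀, ξ⟫_ℝ : ℝ) : ℂ)) with hE
  have hΨ : ContDiff ℝ (⊤ : ℕ∞) fun ξ : Rn n => ((ψ (t • ξ) : ℝ) : ℂ) :=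
    Complex.ofRealCLM.contDiff.comp (hψs.comp (contDiff_const_smul t))
  have hbs : ContDiff ℝ (⊤ : ℕ∞) b := (ha.1 y).mul hΨ
  have hEs : ContDiff ℝ (⊤ : ℕ∞) E :=
    (contDiff_cexp_I_mul_inner _).sub (contDiff_cexp_I_mul_inner _)
  have hgs : ContDiff ℝ (⊤ : ℕ∞) fun ξ => E ξ * b ξ := hEs.mul hbs
  have hbsupp : Function.support b ⊆ {ξ : Rn n | r ≤ ‖ξ‖ ∧ ‖ξ‖ ≤ R} := by
    intro ξ hξ
    have h0 : ψ (t • ξ) ≠ 0 := fun h => hξ (by simp [hb, h])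
    have h1 := hψt (subset_tsupport ψ h0)
    simp only [Set.mem_ofPred_eq, norm_smul, Real.norm_of_nonneg ht0.le] at h1
    rw [ht, inv_mul_eq_div, le_div_iff₀ (by positivity), div_le_iff₀ (by positivity)] at h1
    exact h1
  have hclosed : IsClosed {ξ : Rn n | r ≤ ‖ξ‖ ∧ ‖ξ‖ ≤ R} :=
    (isClosed_le continuous_const continuous_norm).inter
      (isClosed_le continuous_norm continuous_const)
  have hgt : tsupport (fun ξ => E ξ * b ξ) ⊆ {ξ : Rn n | r ≤ ‖ξ‖ ∧ ‖ξ‖ ≤ R} :=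
    closure_minimal (fun ξ hξ => hbsupp (right_ne_zero_of_mul hξ)) hclosed
  have hbc : HasCompactSupport b :=
    HasCompactSupport.of_support_subset_isCompact (isCompact_closedBall 0 R)
      fun ξ hξ => by simpa using (hbsupp hξ).2
  have hn' : (1 : ℝ) ≤ n := by exact_mod_cast hn
  have hle : ∀ k : ℕ, ((k : ℕ) : WithTop ℕ∞) ≤ ((⊤ : ℕ∞) : WithTop ℕ∞) := fun k => by
    exact_mod_cast le_top
  set D : ℝ := 2 ^ N * (2 * (n : ℝ) ^ (N + 1) * l * R * (2 ^ N * (B * (r ^ n)⁻¹ * M))) with hD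
  have hbd : ∀ k ≤ N, ∀ ξ, ‖iteratedFDeriv ℝ k (fun ξ => E ξ * b ξ) ξ‖ ≤ D := by
    intro k hk ξ
    by_cases hξ : iteratedFDeriv ℝ k (fun ξ => E ξ * b ξ) ξ = 0
    · rw [hξ, norm_zero]
      positivity
    obtain ⟨hξr, hξR⟩ := hgt (support_iteratedFDeriv_subset k hξ)
    have haξ : ∀ i ≤ N, ‖iteratedFDeriv ℝ i (a y) ξ‖ ≤ B * (r ^ n)⁻¹ := by
      intro i hi
      refine (hy i hi ξ).trans ?_
      gcongr
      calc (1 + ‖ξ‖ ^ 2) ^ (-(n : ℝ) / 2) ≤ (r ^ 2) ^ (-(n : ℝ) / 2) := by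
            refine Real.rpow_le_rpow_of_nonpos (by positivity) ?_ (by linarith)
            nlinarith
        _ = (r ^ n)⁻¹ := by
            rw [← Real.rpow_natCast_mul hr0.le]
            have : ((2 : ℕ) : ℝ) * (-(n : ℝ) / 2) = -(n : ℝ) := by push_cast; ring
            rw [this, Real.rpow_neg hr0.le, Real.rpow_natCast]
    have hbξ : ∀ i ≤ N, ‖iteratedFDeriv ℝ i b ξ‖ ≤ 2 ^ N * (B * (r ^ n)⁻¹ * M) := by
      intro i hi
      refine (norm_iteratedFDeriv_mul_le_of_le ((ha.1 y).of_le (hle i)) (hΨ.of_le (hle i))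
        (by positivity) (fun m hm => haξ m (hm.trans hi))
        fun m hm => hψM t ht1 m (hm.trans hi) ξ).trans ?_
      gcongr
      exact one_le_two
    refine (norm_iteratedFDeriv_mul_le_of_le (hEs.of_le (hle k)) (hbs.of_le (hle k))
      (by positivity) (fun m hm => norm_iteratedFDeriv_cexp_sub_cexp_le N hl.le hl1.le hR1 hn'
        (norm_sub_le_of_mem_cube hl.le hx) (norm_sub_le_of_mem_cube hl.le hz) hξR (hm.trans hk))
      fun m hm => hbξ m (hm.trans hk)).trans ?_
    rw [hD]
    gcongr
    exact one_le_two
  have main := norm_integral_cexp_mul_le_div N hgs (R := R) (D := D) (by positivity)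
    (by positivity) (fun ξ hξ => by simpa using (hgt hξ).2) hbd (x₀ - y)
  rw [KjStar_sub_KjStar hbs.continuous hbc x z x₀, norm_mul, Complex.norm_real,
    Real.norm_of_nonneg (by positivity)]
  refine (mul_le_mul_of_nonneg_left main (by positivity)).trans (le_of_eq ?_)
  have hDR : D * R ^ n = 2 ^ N * (2 * (n : ℝ) ^ (N + 1) * (2 * C₀) * (2 ^ N * (B * M))) *
      (2 * C₀ ^ 2) ^ n * (2 ^ j * l) := by
    have h : (2 * C₀ ^ 2) ^ n = R ^ n * (r ^ n)⁻¹ := by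
      rw [← div_eq_mul_inv, ← div_pow]
      congr 1
      rw [hR, hr]
      field_simp
    rw [h, hD, hR]
    ring
  rw [hDR]
  ring

/-- If `a ∈ L^∞S^{-n}_0`, then for `0 < l < 1`, `j ≥ 1`, and
`x, z ∈ Q(x₀, l)`: `∫ |u(y)| |K_j^*(x,y) - K_j^*(z,y)| dy ≤ C 2^j l Mu(x₀)`. -/
theorem stmt9 (n : ℕ) (hn : 1 ≤ n)
    (a : Rn n → Rn n → ℂ) (ha : RoughClass (-(n : ℝ)) 0 a)
    (C₀ : ℝ) (hC₀ : 1 < C₀) (ψ : Rn n → ℝ) (hψ : LPcut C₀ ψ) :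
    ∃ C : ℝ, 0 < C ∧ ∀ l : ℝ, 0 < l → l < 1 → ∀ j : ℕ, 1 ≤ j → ∀ x₀ : Rn n,
      ∀ u : SchwartzMap (Rn n) ℂ, ∀ x ∈ cube x₀ l, ∀ z ∈ cube x₀ l,
        (∫⁻ y : Rn n, (‖u y‖₊ : ℝ≥0∞) * (‖KjStar a ψ j x y - KjStar a ψ j z y‖₊ : ℝ≥0∞)) ≤
          ENNReal.ofReal (C * 2 ^ j * l) * mHL (⇑u) x₀ := by
  obtain ⟨C, hC, hK⟩ := exists_norm_KjStar_sub_le hn ha hC₀ hψ (n + 1)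
  refine ⟨(C + 1) * (2 * 4 ^ n), by positivity, ?_⟩
  intro l hl hl1 j _ x₀ u x hx z hz
  have hpt : ∀ᵐ y : Rn n, (‖u y‖₊ : ℝ≥0∞) *
      (‖KjStar a ψ j x y - KjStar a ψ j z y‖₊ : ℝ≥0∞) ≤
      ENNReal.ofReal ((C + 1) * 2 ^ j * l) *
        ((‖u y‖₊ : ℝ≥0∞) * ENNReal.ofReal (((1 + ‖x₀ - y‖) ^ (n + 1))⁻¹)) := by
    filter_upwards [hK] with y hy
    rw [mul_left_comm, ← ENNReal.ofReal_mul (by positivity)]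
    gcongr
    rw [← enorm_eq_nnnorm, ← ofReal_norm]
    refine ENNReal.ofReal_le_ofReal ((hy l hl hl1 j x₀ x hx z hz).trans ?_)
    gcongr
    linarith
  refine (lintegral_mono_ae hpt).trans ?_
  rw [lintegral_const_mul' _ _ ENNReal.ofReal_ne_top]
  refine (mul_le_mul_right
    (lintegral_mul_weight_le_mHL u u.continuous.measurable x₀) _).trans (le_of_eq ?_)
  rw [← mul_assoc, ← ENNReal.ofReal_mul (by positivity)]
  congr 2
  ring
end
end

section
/- Let n ≥ 1, 0 ≤ δ < 1 and a ∈ S^{−n−(n/2)δ}_{0,δ}. There is a constant C such that for every 0 < l < 1, every positive integer j with 2^j ≥ l^{-1}, every x_0 ∈ ℝⁿ, and every Schwartz function u: |Q(x_0,l)|^{-1} ∫_{Q(x_0,l)} |T_j u(x)| dx ≤ C 2^{−jn/2} l^{−n/2} Mu(x_0). -/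
open MeasureTheory Real
open scoped ENNReal NNReal InnerProductSpace BigOperators

noncomputable section

/-- The oscillating factor `e^{i⟨x,ζ⟩}`. -/
def wave {n : ℕ} (x ζ : Rn n) : ℂ := Complex.exp (Complex.I * ((⟪x, ζ⟫_ℝ : ℝ) : ℂ))

lemma norm_wave {n : ℕ} (x ζ : Rn n) : ‖wave x ζ‖ = 1 := by
  rw [wave, mul_comm, Complex.norm_exp_ofReal_mul_I]

lemma wave_comm {n : ℕ} (x ζ : Rn n) : wave x ζ = wave ζ x := by
  rw [wave, wave, real_inner_comm]

lemma continuous_wave {n : ℕ} : Continuous fun p : Rn n × Rn n => wave p.1 p.2 := by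
  unfold wave; fun_prop

lemma hasFDerivAt_wave {n : ℕ} (ζ x : Rn n) :
    HasFDerivAt (fun x => wave x ζ)
      (wave x ζ • (Complex.I • (Complex.ofRealCLM.comp (innerSL ℝ ζ)))) x := by
  have h1 : HasFDerivAt (fun x : Rn n => ((⟪x, ζ⟫_ℝ : ℝ) : ℂ))
      (Complex.ofRealCLM.comp (innerSL ℝ ζ)) x := by
    have := (Complex.ofRealCLM.comp (innerSL ℝ ζ)).hasFDerivAt (x := x)
    convert! this using 2 with y
    simp [real_inner_comm]
  exact (h1.const_mul Complex.I).cexp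

lemma fderiv_wave {n : ℕ} (ζ x v : Rn n) :
    fderiv ℝ (fun x => wave x ζ) x v = wave x ζ * (Complex.I * ((⟪v, ζ⟫_ℝ : ℝ) : ℂ)) := by
  rw [(hasFDerivAt_wave ζ x).fderiv]
  simp [real_inner_comm]

lemma inner_mul_integral_wave {n : ℕ} (ζ v : Rn n) {f : Rn n → ℂ} (hf : ContDiff ℝ 1 f)
    (hc : HasCompactSupport f) :
    ((⟪v, ζ⟫_ℝ : ℝ) : ℂ) * ∫ x, wave x ζ * f x =
      Complex.I * ∫ x, wave x ζ * fderiv ℝ f x v := by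
  have hw : Continuous fun x : Rn n => wave x ζ :=
    continuous_wave.comp (continuous_id.prodMk continuous_const)
  have hdf : Continuous fun x => fderiv ℝ f x v :=
    (hf.continuous_fderiv one_ne_zero).clm_apply continuous_const
  have hdc : HasCompactSupport fun x => fderiv ℝ f x v := hc.fderiv_apply (𝕜 := ℝ) v
  have key := integral_mul_fderiv_eq_neg_fderiv_mul_of_integrable (μ := (volume : Measure (Rn n)))
    (f := fun x => wave x ζ) (g := f) (v := v)
    (by
      simp_rw [fderiv_wave]
      exact ((hw.mul continuous_const).mul hf.continuous).integrable_of_hasCompactSupport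
        hc.mul_left)
    ((hw.mul hdf).integrable_of_hasCompactSupport hdc.mul_left)
    ((hw.mul hf.continuous).integrable_of_hasCompactSupport hc.mul_left)
    (fun x _ => (hasFDerivAt_wave ζ x).differentiableAt)
    (fun x _ => (hf.differentiable one_ne_zero) x)
  rw [key]
  simp_rw [fderiv_wave]
  rw [← integral_neg, ← integral_const_mul, ← integral_const_mul]
  congr 1; ext x
  linear_combination (((⟪v, ζ⟫_ℝ : ℝ) : ℂ) * wave x ζ * f x) * Complex.I_mul_I

lemma norm_iteratedFDeriv_fderiv_apply_le {E F : Type*} [NormedAddCommGroup E] [NormedSpace ℝ E]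
    [NormedAddCommGroup F] [NormedSpace ℝ F] {f : E → F} (hf : ContDiff ℝ (⊤ : ℕ∞) f)
    {v : E} (hv : ‖v‖ ≤ 1) (p : ℕ) (x : E) :
    ‖iteratedFDeriv ℝ p (fun y => fderiv ℝ f y v) x‖ ≤ ‖iteratedFDeriv ℝ (p + 1) f x‖ := by
  have h1 : ContDiff ℝ (⊤ : ℕ∞) (fderiv ℝ f) := hf.fderiv_right (by simp)
  refine (norm_iteratedFDeriv_clm_apply_const (N := (⊤ : ℕ∞)) h1.contDiffAt
    (by exact_mod_cast le_top)).trans ?_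
  rw [norm_iteratedFDeriv_fderiv]
  exact mul_le_of_le_one_left (norm_nonneg _) hv

/-- Repeated integration by parts in one direction. -/
lemma abs_inner_pow_mul_norm_integral_wave_le {n : ℕ} (ζ v x₀ : Rn n) (hv : ‖v‖ ≤ 1) (r M : ℝ)
    (p : ℕ) : ∀ f : Rn n → ℂ, ContDiff ℝ (⊤ : ℕ∞) f → tsupport f ⊆ Metric.closedBall x₀ r →
      (∀ x, ‖iteratedFDeriv ℝ p f x‖ ≤ M) →
      |⟪v, ζ⟫_ℝ| ^ p * ‖∫ x, wave x ζ * f x‖ ≤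
        M * volume.real (Metric.closedBall x₀ r) := by
  induction p with
  | zero =>
    intro f hf hs hM
    rw [pow_zero, one_mul]
    have h0 : ∫ x, wave x ζ * f x = ∫ x in Metric.closedBall x₀ r, wave x ζ * f x := by
      symm
      apply setIntegral_eq_integral_of_forall_compl_eq_zero
      intro x hx
      rw [image_eq_zero_of_notMem_tsupport (fun h => hx (hs h)), mul_zero]
    rw [h0]
    refine norm_setIntegral_le_of_norm_le_const
      (isCompact_closedBall x₀ r).measure_lt_top ?_
    intro x _
    rw [norm_mul, norm_wave, one_mul]
    simpa using hM x
  | succ p ih =>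
    intro f hf hs hM
    have hc : HasCompactSupport f :=
      (isCompact_closedBall x₀ r).of_isClosed_subset (isClosed_tsupport f) hs
    have h1 : |⟪v, ζ⟫_ℝ| * ‖∫ x, wave x ζ * f x‖ = ‖∫ x, wave x ζ * fderiv ℝ f x v‖ := by
      have := congrArg norm (inner_mul_integral_wave ζ v (hf.of_le (by exact_mod_cast le_top)) hc)
      simpa using this
    rw [pow_succ, mul_assoc, h1]
    apply ih
    · exact (hf.fderiv_right (m := (⊤ : ℕ∞)) (by simp)).clm_apply contDiff_const
    · exact (tsupport_fderiv_apply_subset ℝ v).trans hs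
    · exact fun x => (norm_iteratedFDeriv_fderiv_apply_le hf hv p x).trans (hM x)

lemma norm_integral_wave_le {n : ℕ} (ζ x₀ : Rn n) {r Q H : ℝ} (N : ℕ) (hH : 0 < H)
    {f : Rn n → ℂ} (hf : ContDiff ℝ (⊤ : ℕ∞) f) (hs : tsupport f ⊆ Metric.closedBall x₀ r)
    (h0 : ∀ x, ‖f x‖ ≤ Q) (hN : ∀ x, ‖iteratedFDeriv ℝ N f x‖ ≤ Q * H ^ N) :
    ‖∫ x, wave x ζ * f x‖ ≤ 2 ^ (N + 1) * Q * volume.real (Metric.closedBall x₀ r) *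
      ((1 + ‖H⁻¹ • ζ‖) ^ N)⁻¹ := by
  set V := volume.real (Metric.closedBall x₀ r)
  set I := ‖∫ x, wave x ζ * f x‖
  have hI : 0 ≤ I := norm_nonneg _
  have e0 : I ≤ Q * V := by
    have := abs_inner_pow_mul_norm_integral_wave_le ζ 0 x₀ (by simp) r Q 0 f hf hs
      (by simpa using h0)
    simpa using this
  have e1 : ‖ζ‖ ^ N * I ≤ Q * H ^ N * V := by
    rcases eq_or_ne ζ 0 with rfl | hζ
    · have := abs_inner_pow_mul_norm_integral_wave_le 0 0 x₀ (by simp) r (Q * H ^ N) N f hf hs hN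
      simpa using this
    · have := abs_inner_pow_mul_norm_integral_wave_le ζ (‖ζ‖⁻¹ • ζ) x₀
        (by rw [norm_smul, norm_inv, norm_norm, inv_mul_cancel₀ (norm_ne_zero_iff.2 hζ)])
        r (Q * H ^ N) N f hf hs hN
      rw [real_inner_smul_left, real_inner_self_eq_norm_sq, pow_two, ← mul_assoc,
        inv_mul_cancel₀ (norm_ne_zero_iff.2 hζ), one_mul, abs_norm] at this
      exact this
  have e2 : ‖H⁻¹ • ζ‖ ^ N * I ≤ Q * V := by
    rw [norm_smul, norm_inv, Real.norm_of_nonneg hH.le, mul_pow, inv_pow, mul_assoc,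
      inv_mul_le_iff₀ (by positivity)]
    linarith
  rw [← div_eq_mul_inv, le_div_iff₀ (by positivity)]
  have e3 : (1 + ‖H⁻¹ • ζ‖) ^ N ≤ 2 ^ N * (1 + ‖H⁻¹ • ζ‖ ^ N) := by
    have := add_pow_le (zero_le_one) (norm_nonneg (H⁻¹ • ζ)) N
    rw [one_pow] at this
    refine this.trans ?_
    gcongr
    · norm_num
    · omega
  calc I * (1 + ‖H⁻¹ • ζ‖) ^ N ≤ I * (2 ^ N * (1 + ‖H⁻¹ • ζ‖ ^ N)) := by gcongr
    _ = 2 ^ N * (I + ‖H⁻¹ • ζ‖ ^ N * I) := by ring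
    _ ≤ 2 ^ N * (Q * V + Q * V) := by gcongr
    _ = _ := by ring

lemma norm_iteratedFDeriv_mul_le_geom {E : Type*} [NormedAddCommGroup E] [NormedSpace ℝ E]
    {f g : E → ℂ} (hf : ContDiff ℝ (⊤ : ℕ∞) f) (hg : ContDiff ℝ (⊤ : ℕ∞) g) {P Q H : ℝ}
    {N : ℕ} (x : E) (hP : 0 ≤ P) (hQ : 0 ≤ Q) (hH : 0 ≤ H)
    (hf' : ∀ l ≤ N, ‖iteratedFDeriv ℝ l f x‖ ≤ P * H ^ l)
    (hg' : ∀ l ≤ N, ‖iteratedFDeriv ℝ l g x‖ ≤ Q * H ^ l) :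
    ∀ l ≤ N, ‖iteratedFDeriv ℝ l (fun y => f y * g y) x‖ ≤ 2 ^ N * (P * Q) * H ^ l := by
  intro l hl
  refine (norm_iteratedFDeriv_mul_le hf hg x (n := l) (by exact_mod_cast le_top)).trans ?_
  calc ∑ i ∈ Finset.range (l + 1), (l.choose i : ℝ) * ‖iteratedFDeriv ℝ i f x‖ *
        ‖iteratedFDeriv ℝ (l - i) g x‖
      ≤ ∑ i ∈ Finset.range (l + 1), (l.choose i : ℝ) * (P * Q * H ^ l) := by
        refine Finset.sum_le_sum fun i hi => ?_
        have hi' : i ≤ l := Nat.lt_succ_iff.1 (Finset.mem_range.1 hi)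
        have h1 := hf' i (hi'.trans hl)
        have h2 := hg' (l - i) ((Nat.sub_le _ _).trans hl)
        calc _ ≤ (l.choose i : ℝ) * (P * H ^ i) * (Q * H ^ (l - i)) := by gcongr
          _ = (l.choose i : ℝ) * (P * Q * (H ^ i * H ^ (l - i))) := by ring
          _ = _ := by rw [← pow_add, Nat.add_sub_cancel' hi']
    _ = 2 ^ l * (P * Q * H ^ l) := by
        rw [← Finset.sum_mul]
        congr 1
        exact_mod_cast Nat.sum_range_choose l
    _ ≤ 2 ^ N * (P * Q * H ^ l) := by
        gcongr
        norm_num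
    _ = _ := by ring

lemma wave_mul_conj {n : ℕ} (x y ξ ξ' : Rn n) :
    wave (x - y) ξ * (starRingEnd ℂ) (wave (x - y) ξ') =
      wave (-y) (ξ - ξ') * wave x (ξ - ξ') := by
  simp only [wave, ← Complex.exp_conj, ← Complex.exp_add, map_mul, Complex.conj_I,
    Complex.conj_ofReal]
  congr 1
  simp only [inner_sub_left, inner_sub_right, inner_neg_left]
  push_cast
  ring

/-- The constant in the `L²` estimate `lintegral_sq_integral_wave_le`. -/
def waveConst (n : ℕ) (x₀ : Rn n) (r R B P H : ℝ) : ℝ :=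
  2 ^ (n + 2) * (2 ^ (n + 1) * (B * (2 ^ (n + 1) * (P * P)))) *
    volume.real (Metric.closedBall x₀ r) *
    (H ^ n * ∫ ξ : Rn n, ((1 + ‖ξ‖) ^ (n + 1))⁻¹) *
    volume.real (Metric.closedBall (0 : Rn n) R)

/-- The `L²` estimate for an oscillatory integral with an amplitude that oscillates at scale
`H⁻¹` in the space variable. -/
lemma lintegral_sq_integral_wave_le {n : ℕ} {χ : Rn n → ℝ} (hχ : ContDiff ℝ (⊤ : ℕ∞) χ)
    {x₀ y : Rn n} {r R B P H : ℝ} (hχs : tsupport χ ⊆ Metric.closedBall x₀ r) (hχ0 : ∀ x, 0 ≤ χ x)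
    {S : Set (Rn n)} (hS : ∀ x ∈ S, 1 ≤ χ x) (hSm : MeasurableSet S)
    (hB : 0 ≤ B) (hP : 0 ≤ P) (hH : 1 ≤ H)
    (hχB : ∀ l ≤ n + 1, ∀ x, ‖iteratedFDeriv ℝ l χ x‖ ≤ B)
    {g : Rn n → Rn n → ℂ} (hgc : Continuous (Function.uncurry g))
    (hg : ∀ ξ, ContDiff ℝ (⊤ : ℕ∞) fun x => g x ξ)
    (hgs : ∀ x ξ, ξ ∉ Metric.closedBall (0 : Rn n) R → g x ξ = 0)
    (hgP : ∀ l ≤ n + 1, ∀ x ξ, ‖iteratedFDeriv ℝ l (fun x => g x ξ) x‖ ≤ P * H ^ l) :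
    ∫⁻ x in S, ‖∫ ξ, wave (x - y) ξ * g x ξ‖ₑ ^ 2 ≤
      ENNReal.ofReal (waveConst n x₀ r R B P H) := by
  rw [waveConst]
  set F : Rn n → ℂ := fun x => ∫ ξ, wave (x - y) ξ * g x ξ
  have hH0 : 0 < H := by linarith
  have hχc : Continuous χ := hχ.continuous
  have hχz : ∀ x, x ∉ Metric.closedBall x₀ r → χ x = 0 := fun x hx =>
    image_eq_zero_of_notMem_tsupport fun h => hx (hχs h)
  let G : Rn n → Rn n × Rn n → ℂ := fun x p =>
    (χ x : ℂ) * ((wave (x - y) p.1 * g x p.1) *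
      (starRingEnd ℂ) (wave (x - y) p.2 * g x p.2))
  have hGc : Continuous (Function.uncurry G) := by
    have h1 : Continuous fun q : Rn n × Rn n × Rn n =>
        wave (q.1 - y) q.2.1 * g q.1 q.2.1 :=
      (continuous_wave.comp (by fun_prop : Continuous fun q : Rn n × Rn n × Rn n =>
        (q.1 - y, q.2.1))).mul (hgc.comp (by fun_prop : Continuous fun q : Rn n × Rn n × Rn n =>
        (q.1, q.2.1)))
    have h2 : Continuous fun q : Rn n × Rn n × Rn n =>
        wave (q.1 - y) q.2.2 * g q.1 q.2.2 :=
      (continuous_wave.comp (by fun_prop : Continuous fun q : Rn n × Rn n × Rn n =>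
        (q.1 - y, q.2.2))).mul (hgc.comp (by fun_prop : Continuous fun q : Rn n × Rn n × Rn n =>
        (q.1, q.2.2)))
    exact (Complex.continuous_ofReal.comp (hχc.comp continuous_fst)).mul
      (h1.mul (Complex.continuous_conj.comp h2))
  have hGi : Integrable (Function.uncurry G) (volume.prod (volume.prod volume)) := by
    refine hGc.integrable_of_hasCompactSupport (HasCompactSupport.intro
      ((isCompact_closedBall x₀ r).prod
        ((isCompact_closedBall (0 : Rn n) R).prod (isCompact_closedBall (0 : Rn n) R))) ?_)
    rintro ⟨x, ξ, ξ'⟩ hx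
    simp only [Set.mem_prod, not_and_or] at hx
    rcases hx with hx | hx | hx
    · simp [G, Function.uncurry, hχz x hx]
    · simp [G, Function.uncurry, hgs x ξ hx]
    · simp [G, Function.uncurry, hgs x ξ' hx]
  have hGF : ∀ x, ∫ p, G x p = ((χ x * ‖F x‖ ^ 2 : ℝ) : ℂ) := by
    intro x
    simp only [G]
    rw [integral_const_mul, Measure.volume_eq_prod,
      integral_prod_mul (fun ξ => wave (x - y) ξ * g x ξ)
        (fun ξ => (starRingEnd ℂ) (wave (x - y) ξ * g x ξ)), integral_conj]
    change (χ x : ℂ) * (F x * (starRingEnd ℂ) (F x)) = _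
    rw [Complex.mul_conj, Complex.normSq_eq_norm_sq]
    push_cast
    rfl
  have hJi : Integrable fun x => χ x * ‖F x‖ ^ 2 := by
    have h1 : Integrable fun x => ∫ p, G x p := hGi.integral_prod_left
    simp_rw [hGF] at h1
    exact h1.re
  have hinner : ∀ p : Rn n × Rn n, ‖∫ x, G x p‖ ≤
      2 ^ (n + 2) * (2 ^ (n + 1) * (B * (2 ^ (n + 1) * (P * P)))) *
        volume.real (Metric.closedBall x₀ r) * ((1 + ‖H⁻¹ • (p.1 - p.2)‖) ^ (n + 1))⁻¹ := by
    rintro ⟨ξ, ξ'⟩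
    have h1 : ∀ x, G x (ξ, ξ') = wave (-y) (ξ - ξ') * (wave x (ξ - ξ') *
        ((χ x : ℂ) * (g x ξ * (starRingEnd ℂ) (g x ξ')))) := by
      intro x
      simp only [G, map_mul]
      linear_combination ((χ x : ℂ) * (g x ξ * (starRingEnd ℂ) (g x ξ'))) *
        wave_mul_conj x y ξ ξ'
    simp_rw [h1]
    rw [integral_const_mul, norm_mul, norm_wave, one_mul]
    have hχ' : ContDiff ℝ (⊤ : ℕ∞) fun x => (χ x : ℂ) := Complex.ofRealCLM.contDiff.comp hχ
    have hg' : ContDiff ℝ (⊤ : ℕ∞) fun x => (starRingEnd ℂ) (g x ξ') :=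
      Complex.conjCLE.contDiff.comp (hg ξ')
    have hχB' : ∀ l ≤ n + 1, ∀ x, ‖iteratedFDeriv ℝ l (fun x => (χ x : ℂ)) x‖ ≤ B * H ^ l := by
      intro l hl x
      have := Complex.ofRealLI.norm_iteratedFDeriv_comp_left (x := x) (f := χ) (i := l)
        (n := (⊤ : ℕ∞)) hχ.contDiffAt (by exact_mod_cast le_top)
      refine (le_of_eq this).trans ((hχB l hl x).trans ?_)
      exact le_mul_of_one_le_right hB (one_le_pow₀ hH)
    have hgB' : ∀ l ≤ n + 1, ∀ x,
        ‖iteratedFDeriv ℝ l (fun x => (starRingEnd ℂ) (g x ξ')) x‖ ≤ P * H ^ l := by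
      intro l hl x
      have := Complex.conjLIE.norm_iteratedFDeriv_comp_left (fun x => g x ξ') x l
      exact (le_of_eq this).trans (hgP l hl x ξ')
    have hb := fun x => norm_iteratedFDeriv_mul_le_geom hχ' ((hg ξ).mul hg') (N := n + 1) x hB
      (by positivity) hH0.le (fun l hl => hχB' l hl x)
      (norm_iteratedFDeriv_mul_le_geom (hg ξ) hg' (N := n + 1) x hP hP hH0.le
        (fun l hl => hgP l hl x ξ) (fun l hl => hgB' l hl x))
    refine norm_integral_wave_le (ξ - ξ') x₀ (n + 1) hH0 (hχ'.mul ((hg ξ).mul hg')) ?_ ?_ ?_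
    · refine (tsupport_mul_subset_left).trans (subset_trans ?_ hχs)
      exact closure_mono fun x hx => by simpa using hx
    · intro x
      simpa using hb x 0 (by omega)
    · intro x
      exact hb x (n + 1) le_rfl
  set M := 2 ^ (n + 2) * (2 ^ (n + 1) * (B * (2 ^ (n + 1) * (P * P)))) *
        volume.real (Metric.closedBall x₀ r) with hM
  have hM0 : 0 ≤ M := by positivity
  set K := ∫ ξ : Rn n, ((1 + ‖ξ‖) ^ (n + 1))⁻¹ with hK
  have hki : Integrable fun ξ : Rn n => ((1 + ‖ξ‖) ^ (n + 1))⁻¹ := by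
    have := integrable_one_add_norm (E := Rn n) (μ := volume) (r := ((n + 1 : ℕ) : ℝ))
      (by simp)
    refine this.congr (Filter.Eventually.of_forall fun ξ => ?_)
    simp only
    rw [Real.rpow_neg (by positivity), Real.rpow_natCast]
  have hki' : Integrable fun ξ : Rn n => ((1 + ‖H⁻¹ • ξ‖) ^ (n + 1))⁻¹ :=
    (integrable_comp_smul_iff volume (fun ξ : Rn n => ((1 + ‖ξ‖) ^ (n + 1))⁻¹)
      (inv_ne_zero hH0.ne')).2 hki
  have hK' : ∫ ξ : Rn n, ((1 + ‖H⁻¹ • ξ‖) ^ (n + 1))⁻¹ = H ^ n * K := by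
    rw [Measure.integral_comp_inv_smul_of_nonneg volume
      (fun ξ : Rn n => ((1 + ‖ξ‖) ^ (n + 1))⁻¹) hH0.le]
    simp [hK]
  have hJ : ∫ x, χ x * ‖F x‖ ^ 2 ≤ M * (H ^ n * K) *
      volume.real (Metric.closedBall (0 : Rn n) R) := by
    have h1 : ((∫ x, χ x * ‖F x‖ ^ 2 : ℝ) : ℂ) = ∫ ξ, ∫ ξ', ∫ x, G x (ξ, ξ') := by
      rw [← integral_complex_ofReal]
      simp_rw [← hGF]
      rw [Measure.volume_eq_prod, integral_integral_swap hGi, integral_prod]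
      exact hGi.integral_prod_right
    have h2 : ∀ ξ, ‖∫ ξ', ∫ x, G x (ξ, ξ')‖ ≤ M * (H ^ n * K) := by
      intro ξ
      have h3 : Integrable fun ξ' => M * ((1 + ‖H⁻¹ • (ξ - ξ')‖) ^ (n + 1))⁻¹ :=
        (hki'.comp_sub_left ξ).const_mul M
      refine (norm_integral_le_of_norm_le h3 (Filter.Eventually.of_forall fun ξ' =>
        hinner (ξ, ξ'))).trans ?_
      rw [integral_const_mul,
        integral_sub_left_eq_self (fun ξ' => ((1 + ‖H⁻¹ • ξ'‖) ^ (n + 1))⁻¹) volume ξ, hK']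
    have h4 : ∫ ξ, ∫ ξ', ∫ x, G x (ξ, ξ') =
        ∫ ξ in Metric.closedBall (0 : Rn n) R, ∫ ξ', ∫ x, G x (ξ, ξ') := by
      symm
      apply setIntegral_eq_integral_of_forall_compl_eq_zero
      intro ξ hξ
      simp [G, hgs _ ξ hξ]
    have h5 := norm_setIntegral_le_of_norm_le_const (f := fun ξ => ∫ ξ', ∫ x, G x (ξ, ξ'))
      (μ := volume) (isCompact_closedBall (0 : Rn n) R).measure_lt_top (fun ξ _ => h2 ξ)
    rw [← h4, ← h1, Complex.norm_real] at h5
    exact (le_abs_self _).trans h5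
  calc ∫⁻ x in S, ‖F x‖ₑ ^ 2 ≤ ∫⁻ x in S, ENNReal.ofReal (χ x * ‖F x‖ ^ 2) := by
        refine setLIntegral_mono' hSm fun x hx => ?_
        rw [← ofReal_norm, ← ENNReal.ofReal_pow (norm_nonneg _)]
        exact ENNReal.ofReal_le_ofReal (le_mul_of_one_le_left (by positivity) (hS x hx))
    _ ≤ ∫⁻ x, ENNReal.ofReal (χ x * ‖F x‖ ^ 2) := setLIntegral_le_lintegral _ _
    _ = ENNReal.ofReal (∫ x, χ x * ‖F x‖ ^ 2) := by
        rw [ofReal_integral_eq_lintegral_ofReal hJi]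
        exact Filter.Eventually.of_forall fun x => mul_nonneg (hχ0 x) (by positivity)
    _ ≤ _ := ENNReal.ofReal_le_ofReal hJ

lemma contDiff_iteratedFDeriv_uncurry {E F G : Type*} [NormedAddCommGroup E] [NormedSpace ℝ E]
    [NormedAddCommGroup F] [NormedSpace ℝ F] [NormedAddCommGroup G] [NormedSpace ℝ G]
    {a : E → F → G} (ha : ContDiff ℝ (⊤ : ℕ∞) (Function.uncurry a)) (k : ℕ) :
    ContDiff ℝ (⊤ : ℕ∞) fun p : E × F => iteratedFDeriv ℝ k (a p.1) p.2 := by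
  induction k with
  | zero =>
    simp only [iteratedFDeriv_zero_eq_comp, Function.comp_def]
    exact (continuousMultilinearCurryFin0 ℝ F G).symm.contDiff.comp ha
  | succ k ih =>
    simp only [iteratedFDeriv_succ_eq_comp_left, Function.comp_def]
    let L : (F →L[ℝ] F [×k]→L[ℝ] G) ≃ₗᵢ[ℝ] (F [×(k + 1)]→L[ℝ] G) :=
      (continuousMultilinearCurryLeftEquiv ℝ (fun _ : Fin (k + 1) => F) G).symm
    have hL : ContDiff ℝ (⊤ : ℕ∞) L := LinearIsometryEquiv.contDiff (𝕜 := ℝ)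
      (E := F →L[ℝ] F [×k]→L[ℝ] G) (F := F [×(k + 1)]→L[ℝ] G) L
    refine ContDiff.comp (g := L) hL ?_
    refine ContDiff.fderiv (m := (⊤ : ℕ∞)) (f := fun (p : E × F) η => iteratedFDeriv ℝ k (a p.1) η)
      ?_ contDiff_snd (by simp)
    exact ih.comp ((contDiff_fst.comp contDiff_fst).prodMk contDiff_snd)

lemma fderiv_iteratedFDeriv_apply_const {E G : Type*} [NormedAddCommGroup E] [NormedSpace ℝ E]
    [NormedAddCommGroup G] [NormedSpace ℝ G] {f : E → G} {k : ℕ} {v ξ : E}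
    (hf : ContDiff ℝ (⊤ : ℕ∞) fun ξ => iteratedFDeriv ℝ k f ξ) :
    fderiv ℝ (fun ξ => iteratedFDeriv ℝ k f ξ (fun _ => v)) ξ v =
      iteratedFDeriv ℝ (k + 1) f ξ (fun _ => v) := by
  have h : HasFDerivAt (fun ξ => iteratedFDeriv ℝ k f ξ (fun _ => v))
      ((ContinuousMultilinearMap.apply ℝ (fun _ : Fin k => E) G (fun _ => v)).comp
        (fderiv ℝ (fun ξ => iteratedFDeriv ℝ k f ξ) ξ)) ξ :=
    (ContinuousMultilinearMap.apply ℝ (fun _ : Fin k => E) G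
      (fun _ => v)).hasFDerivAt.comp ξ (hf.differentiable (by simp) ξ).hasFDerivAt
  rw [h.fderiv, iteratedFDeriv_succ_apply_left]
  rfl

lemma norm_smul_apply_le {n k : ℕ} {v : Rn n} (hv : ‖v‖ ≤ 1) (c : ℂ) :
    ‖c • ContinuousMultilinearMap.apply ℝ (fun _ : Fin k => Rn n) ℂ (fun _ => v)‖ ≤ ‖c‖ := by
  refine ContinuousLinearMap.opNorm_le_bound _ (norm_nonneg _) fun m => ?_
  rw [smul_apply, norm_smul]
  gcongr
  refine (m.le_opNorm _).trans (mul_le_of_le_one_right (norm_nonneg _) ?_)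
  exact Finset.prod_le_one (fun _ _ => norm_nonneg _) fun _ _ => hv

lemma norm_iteratedFDeriv_apply_mul_le {n k l : ℕ} {a : Rn n → Rn n → ℂ}
    (ha : ContDiff ℝ (⊤ : ℕ∞) (Function.uncurry a)) {v : Rn n} (hv : ‖v‖ ≤ 1) (c : ℂ)
    (x ξ : Rn n) :
    ‖iteratedFDeriv ℝ l (fun x => iteratedFDeriv ℝ k (a x) ξ (fun _ => v) * c) x‖ ≤
      ‖iteratedFDeriv ℝ l (fun x => iteratedFDeriv ℝ k (a x) ξ) x‖ * ‖c‖ := by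
  have h1 : ContDiff ℝ (⊤ : ℕ∞) fun x => iteratedFDeriv ℝ k (a x) ξ :=
    (contDiff_iteratedFDeriv_uncurry ha k).comp (contDiff_id.prodMk contDiff_const)
  have h2 := (c • ContinuousMultilinearMap.apply ℝ (fun _ : Fin k => Rn n) ℂ
    (fun _ => v)).norm_iteratedFDeriv_comp_left (n := l) (x := x)
    (N := (⊤ : ℕ∞)) h1.contDiffAt (by exact_mod_cast le_top)
  have h3 : (fun x => iteratedFDeriv ℝ k (a x) ξ (fun _ => v) * c) =
      (c • ContinuousMultilinearMap.apply ℝ (fun _ : Fin k => Rn n) ℂ (fun _ => v)) ∘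
        fun x => iteratedFDeriv ℝ k (a x) ξ := by
    ext x
    simp [mul_comm]
  rw [h3, mul_comm]
  exact h2.trans (mul_le_mul_of_nonneg_right (norm_smul_apply_le hv c) (norm_nonneg _))

lemma measurable_integral_wave {n : ℕ} {g : Rn n → Rn n → ℂ}
    (hg : Continuous (Function.uncurry g)) :
    Measurable fun p : Rn n × Rn n => ∫ ξ, wave (p.1 - p.2) ξ * g p.1 ξ := by
  have h1 : Continuous fun q : (Rn n × Rn n) × Rn n => wave (q.1.1 - q.1.2) q.2 * g q.1.1 q.2 :=
    (continuous_wave.comp (by fun_prop : Continuous fun q : (Rn n × Rn n) × Rn n =>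
      (q.1.1 - q.1.2, q.2))).mul (hg.comp (by fun_prop : Continuous fun q : (Rn n × Rn n) × Rn n =>
      (q.1.1, q.2)))
  exact (h1.stronglyMeasurable.integral_prod_right (ν := volume)).measurable

lemma enorm_I_mul_add_sq_le (a b : ℂ) :
    ‖Complex.I * (a + b)‖ₑ ^ 2 ≤ 2 * (‖a‖ₑ ^ 2 + ‖b‖ₑ ^ 2) := by
  have hI : ‖Complex.I‖ₑ = 1 := by rw [← ofReal_norm, Complex.norm_I, ENNReal.ofReal_one]
  rw [enorm_mul, hI, one_mul]
  have h1 : ‖a + b‖ ^ 2 ≤ 2 * (‖a‖ ^ 2 + ‖b‖ ^ 2) := by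
    nlinarith [norm_add_le a b, norm_nonneg (a + b), sq_nonneg (‖a‖ - ‖b‖)]
  have h2 := ENNReal.ofReal_le_ofReal h1
  rw [ENNReal.ofReal_mul (by norm_num), ENNReal.ofReal_add (by positivity) (by positivity)] at h2
  simpa [ENNReal.ofReal_pow] using h2

/-- The weighted `L²` estimate, obtained by integrating by parts in the frequency variable. -/
lemma lintegral_sq_inner_pow_mul_integral_wave_le {n : ℕ} {χ : Rn n → ℝ}
    (hχ : ContDiff ℝ (⊤ : ℕ∞) χ)
    {x₀ y v : Rn n} {r R B P H D : ℝ} (hχs : tsupport χ ⊆ Metric.closedBall x₀ r)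
    (hχ0 : ∀ x, 0 ≤ χ x)
    {S Ω : Set (Rn n)} (hS : ∀ x ∈ S, 1 ≤ χ x) (hSm : MeasurableSet S)
    (hΩ : Ω ⊆ Metric.closedBall (0 : Rn n) R)
    (hB : 0 ≤ B) (hP : 0 ≤ P) (hH : 1 ≤ H) (hD : 0 ≤ D) (hv : ‖v‖ ≤ 1)
    (hχB : ∀ l ≤ n + 1, ∀ x, ‖iteratedFDeriv ℝ l χ x‖ ≤ B)
    {a : Rn n → Rn n → ℂ} (ha : ContDiff ℝ (⊤ : ℕ∞) (Function.uncurry a)) (p : ℕ) :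
    ∀ (k : ℕ) (φ : Rn n → ℂ), ContDiff ℝ (⊤ : ℕ∞) φ → tsupport φ ⊆ Ω →
      (∀ q ≤ p, ∀ ξ, ‖iteratedFDeriv ℝ q φ ξ‖ ≤ D) →
      (∀ k' ≤ k + p, ∀ l ≤ n + 1, ∀ x, ∀ ξ ∈ Ω,
        ‖iteratedFDeriv ℝ l (fun x => iteratedFDeriv ℝ k' (a x) ξ) x‖ ≤ P * H ^ l) →
      ∫⁻ x in S, ‖((⟪v, x - y⟫_ℝ : ℝ) : ℂ) ^ p *
          ∫ ξ, wave (x - y) ξ * (iteratedFDeriv ℝ k (a x) ξ (fun _ => v) * φ ξ)‖ₑ ^ 2 ≤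
        4 ^ p * ENNReal.ofReal (waveConst n x₀ r R B (P * D) H) := by
  have hAc : ∀ k, ContDiff ℝ (⊤ : ℕ∞) fun q : Rn n × Rn n =>
      iteratedFDeriv ℝ k (a q.1) q.2 (fun _ => v) := fun k =>
    (ContinuousMultilinearMap.apply ℝ (fun _ : Fin k => Rn n) ℂ (fun _ => v)).contDiff.comp
      (contDiff_iteratedFDeriv_uncurry ha k)
  induction p with
  | zero =>
    intro k φ hφ hφs hφD haP
    simp only [pow_zero, one_mul]
    refine lintegral_sq_integral_wave_le hχ hχs hχ0 hS hSm hB (by positivity) hH hχB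
      (g := fun x ξ => iteratedFDeriv ℝ k (a x) ξ (fun _ => v) * φ ξ)
      ((hAc k).continuous.mul (hφ.continuous.comp continuous_snd)) ?_ ?_ ?_
    · intro ξ
      exact ((hAc k).comp (contDiff_id.prodMk contDiff_const)).mul contDiff_const
    · intro x ξ hξ
      rw [image_eq_zero_of_notMem_tsupport fun h => hξ (hΩ (hφs h)), mul_zero]
    · intro l hl x ξ
      by_cases hξ : ξ ∈ Ω
      · refine (norm_iteratedFDeriv_apply_mul_le ha hv (φ ξ) x ξ).trans ?_
        have h1 := haP k (by omega) l hl x ξ hξ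
        have h2 := hφD 0 le_rfl ξ
        rw [norm_iteratedFDeriv_zero] at h2
        calc _ ≤ (P * H ^ l) * D := by gcongr
          _ = _ := by ring
      · refine (norm_iteratedFDeriv_apply_mul_le ha hv (φ ξ) x ξ).trans ?_
        rw [image_eq_zero_of_notMem_tsupport fun h => hξ (hφs h), norm_zero, mul_zero]
        positivity
  | succ p ih =>
    intro k φ hφ hφs hφD haP
    have hφ' : ContDiff ℝ (⊤ : ℕ∞) fun ξ => fderiv ℝ φ ξ v :=
      (hφ.fderiv_right (m := (⊤ : ℕ∞)) (by simp)).clm_apply contDiff_const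
    have hφs' : tsupport (fun ξ => fderiv ℝ φ ξ v) ⊆ Ω :=
      (tsupport_fderiv_apply_subset ℝ v).trans hφs
    have hcpt : ∀ {φ : Rn n → ℂ}, tsupport φ ⊆ Ω → HasCompactSupport φ := fun h =>
      (isCompact_closedBall (0 : Rn n) R).of_isClosed_subset (isClosed_tsupport _) (h.trans hΩ)
    have i1 := ih (k + 1) φ hφ hφs (fun q hq => hφD q (by omega))
      (fun k' hk' => haP k' (by omega))
    have i2 := ih k (fun ξ => fderiv ℝ φ ξ v) hφ' hφs'
      (fun q hq ξ => (norm_iteratedFDeriv_fderiv_apply_le hφ hv q ξ).trans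
        (hφD (q + 1) (by omega) ξ))
      (fun k' hk' => haP k' (by omega))
    have key : ∀ x, ((⟪v, x - y⟫_ℝ : ℝ) : ℂ) ^ (p + 1) *
          ∫ ξ, wave (x - y) ξ * (iteratedFDeriv ℝ k (a x) ξ (fun _ => v) * φ ξ) =
        Complex.I * ((((⟪v, x - y⟫_ℝ : ℝ) : ℂ) ^ p *
            ∫ ξ, wave (x - y) ξ * (iteratedFDeriv ℝ (k + 1) (a x) ξ (fun _ => v) * φ ξ)) +
          ((⟪v, x - y⟫_ℝ : ℝ) : ℂ) ^ p *
            ∫ ξ, wave (x - y) ξ *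
              (iteratedFDeriv ℝ k (a x) ξ (fun _ => v) * fderiv ℝ φ ξ v)) := by
      intro x
      have hax : ContDiff ℝ (⊤ : ℕ∞) fun ξ => iteratedFDeriv ℝ k (a x) ξ :=
        (contDiff_iteratedFDeriv_uncurry ha k).comp (contDiff_const.prodMk contDiff_id)
      have hA : ∀ k, ContDiff ℝ (⊤ : ℕ∞) fun ξ => iteratedFDeriv ℝ k (a x) ξ (fun _ => v) :=
        fun k => (hAc k).comp (contDiff_const.prodMk contDiff_id)
      have hd : ∀ ξ, fderiv ℝ (fun ξ => iteratedFDeriv ℝ k (a x) ξ (fun _ => v) * φ ξ) ξ v =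
          iteratedFDeriv ℝ (k + 1) (a x) ξ (fun _ => v) * φ ξ +
            iteratedFDeriv ℝ k (a x) ξ (fun _ => v) * fderiv ℝ φ ξ v := by
        intro ξ
        have d1 : DifferentiableAt ℝ (fun ξ => iteratedFDeriv ℝ k (a x) ξ (fun _ => v)) ξ :=
          (hA k).differentiable (by simp) ξ
        have d2 : DifferentiableAt ℝ φ ξ := hφ.differentiable (by simp) ξ
        rw [fderiv_fun_mul d1 d2, add_apply, smul_apply, smul_apply,
          fderiv_iteratedFDeriv_apply_const hax]
        simp only [smul_eq_mul]
        ring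
      have h1 := inner_mul_integral_wave (x - y) v
        (f := fun ξ => iteratedFDeriv ℝ k (a x) ξ (fun _ => v) * φ ξ)
        (((hA k).mul hφ).of_le (by exact_mod_cast le_top)) (hcpt hφs).mul_left
      simp_rw [hd, mul_add] at h1
      have hw : Continuous fun ξ => wave ξ (x - y) :=
        continuous_wave.comp (continuous_id.prodMk continuous_const)
      rw [integral_add] at h1
      · simp_rw [wave_comm (x - y)]
        rw [pow_succ, mul_assoc, h1]
        ring
      · exact (hw.mul ((hA (k + 1)).mul hφ).continuous).integrable_of_hasCompactSupport
          (hcpt hφs).mul_left.mul_left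
      · exact (hw.mul ((hA k).mul hφ').continuous).integrable_of_hasCompactSupport
          (hcpt hφs').mul_left.mul_left
    simp_rw [key]
    have hm : Measurable fun x => ‖((⟪v, x - y⟫_ℝ : ℝ) : ℂ) ^ p *
        ∫ ξ, wave (x - y) ξ * (iteratedFDeriv ℝ (k + 1) (a x) ξ (fun _ => v) * φ ξ)‖ₑ ^ 2 := by
      have h1 := (measurable_integral_wave
        (g := fun x ξ => iteratedFDeriv ℝ (k + 1) (a x) ξ (fun _ => v) * φ ξ)
        ((hAc (k + 1)).continuous.mul (hφ.continuous.comp continuous_snd))).comp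
        (measurable_id.prodMk (measurable_const (a := y)))
      have h2 : Measurable fun x : Rn n => ((⟪v, x - y⟫_ℝ : ℝ) : ℂ) ^ p := by
        apply Continuous.measurable
        fun_prop
      exact (h2.mul h1).enorm.pow_const 2
    calc _ ≤ ∫⁻ x in S, 2 * (‖((⟪v, x - y⟫_ℝ : ℝ) : ℂ) ^ p *
            ∫ ξ, wave (x - y) ξ *
              (iteratedFDeriv ℝ (k + 1) (a x) ξ (fun _ => v) * φ ξ)‖ₑ ^ 2 +
          ‖((⟪v, x - y⟫_ℝ : ℝ) : ℂ) ^ p *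
            ∫ ξ, wave (x - y) ξ *
              (iteratedFDeriv ℝ k (a x) ξ (fun _ => v) * fderiv ℝ φ ξ v)‖ₑ ^ 2) :=
          lintegral_mono fun x => enorm_I_mul_add_sq_le _ _
      _ ≤ 2 * (4 ^ p * ENNReal.ofReal (waveConst n x₀ r R B (P * D) H) +
            4 ^ p * ENNReal.ofReal (waveConst n x₀ r R B (P * D) H)) := by
          rw [lintegral_const_mul' _ _ (by norm_num), lintegral_add_left hm]
          gcongr
      _ = _ := by ring

lemma exists_bound_iteratedFDeriv {E F : Type*} [NormedAddCommGroup E] [NormedSpace ℝ E]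
    [NormedAddCommGroup F] [NormedSpace ℝ F] {f : E → F} (hf : ContDiff ℝ (⊤ : ℕ∞) f)
    (hs : HasCompactSupport f) (N : ℕ) :
    ∃ B : ℝ, 0 ≤ B ∧ ∀ l ≤ N, ∀ x, ‖iteratedFDeriv ℝ l f x‖ ≤ B := by
  have h : ∀ l : ℕ, ∃ C, ∀ x, ‖iteratedFDeriv ℝ l f x‖ ≤ C := fun l =>
    (hs.iteratedFDeriv l).exists_bound_of_continuous
      (hf.continuous_iteratedFDeriv (by exact_mod_cast le_top))
  choose C hC using h
  refine ⟨∑ l ∈ Finset.range (N + 1), |C l|, by positivity, fun l hl x => ?_⟩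
  exact ((hC l x).trans (le_abs_self _)).trans (Finset.single_le_sum
    (f := fun l => |C l|) (fun _ _ => abs_nonneg _) (Finset.mem_range.2 (by omega)))

lemma exists_spatial_cutoff {n : ℕ} (hn : 1 ≤ n) :
    ∃ B : ℝ, 0 ≤ B ∧ ∀ x₀ : Rn n, ∃ χ : Rn n → ℝ, ContDiff ℝ (⊤ : ℕ∞) χ ∧
      tsupport χ ⊆ Metric.closedBall x₀ (2 * n) ∧ (∀ x, 0 ≤ χ x) ∧
      (∀ x ∈ Metric.closedBall x₀ (n : ℝ), 1 ≤ χ x) ∧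
      ∀ l ≤ n + 1, ∀ x, ‖iteratedFDeriv ℝ l χ x‖ ≤ B := by
  have hn0 : (0 : ℝ) < n := by exact_mod_cast hn
  let f : ContDiffBump (0 : Rn n) := ⟨n, 2 * n, hn0, by linarith⟩
  obtain ⟨B, hB, h⟩ := exists_bound_iteratedFDeriv f.contDiff f.hasCompactSupport (n + 1)
  refine ⟨B, hB, fun x₀ => ⟨fun x => f (x - x₀), f.contDiff.comp (contDiff_id.sub contDiff_const),
    fun x hx => ?_, fun x => f.nonneg, fun x hx => ?_, fun l hl x => ?_⟩⟩
  · have h1 := tsupport_comp_subset_preimage f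
      (by fun_prop : Continuous fun x : Rn n => x - x₀) hx
    rw [Set.mem_preimage, f.tsupport_eq] at h1
    simpa [dist_eq_norm] using h1
  · exact (f.one_of_mem_closedBall (by simpa [dist_eq_norm] using hx)).ge
  · rw [iteratedFDeriv_comp_sub]
    exact h l hl _

lemma exists_frequency_cutoff_bound {n : ℕ} {C₀ : ℝ} {ψ : Rn n → ℝ} (hψ : LPcut C₀ ψ) (N : ℕ) :
    ∃ D : ℝ, 0 ≤ D ∧ ∀ j : ℕ, ∀ q ≤ N, ∀ ξ : Rn n,
      ‖iteratedFDeriv ℝ q (fun ξ => ((ψ ((((2 : ℝ) ^ j)⁻¹) • ξ) : ℝ) : ℂ)) ξ‖ ≤ D := by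
  have h1 : ContDiff ℝ (⊤ : ℕ∞) fun ξ : Rn n => ((ψ ξ : ℝ) : ℂ) :=
    Complex.ofRealCLM.contDiff.comp hψ.1
  obtain ⟨D, hD, h⟩ := exists_bound_iteratedFDeriv h1
    (hψ.2.1.comp_left (g := ((↑) : ℝ → ℂ)) Complex.ofReal_zero) N
  refine ⟨D, hD, fun j q hq ξ => ?_⟩
  rw [iteratedFDeriv_comp_const_smul (f := fun ξ : Rn n => ((ψ ξ : ℝ) : ℂ)) _
    (h1.of_le (by exact_mod_cast le_top))]
  rw [norm_smul]
  refine (mul_le_of_le_one_left (norm_nonneg _) ?_).trans (h q hq _)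
  rw [norm_pow, norm_inv, norm_pow, Real.norm_ofNat]
  exact pow_le_one₀ (by positivity) (inv_le_one_of_one_le₀ (one_le_pow₀ (by norm_num)))

lemma one_add_sq_rpow_le {C₀ c t s : ℝ} (hC₀ : 1 < C₀) (hc : 1 ≤ c) (h1 : C₀⁻¹ * c ≤ t)
    (h2 : t ≤ 2 * C₀ * c) :
    (1 + t ^ 2) ^ (s / 2) ≤ (1 + 4 * C₀ ^ 2) ^ (|s| / 2) * c ^ s := by
  have hC : 0 < C₀ := by linarith
  have hc0 : 0 < c := by linarith
  have ht : 0 < t := lt_of_lt_of_le (by positivity) h1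
  set A := 1 + 4 * C₀ ^ 2 with hA
  have hA0 : 1 ≤ A := by nlinarith
  have hup : (1 + t ^ 2) ≤ A * c ^ 2 := by
    have : t ^ 2 ≤ (2 * C₀ * c) ^ 2 := by gcongr
    nlinarith
  have hlow : A⁻¹ * c ^ 2 ≤ 1 + t ^ 2 := by
    have h3 : (C₀⁻¹ * c) ^ 2 ≤ t ^ 2 := by gcongr
    have h4 : A⁻¹ ≤ (C₀⁻¹) ^ 2 := by
      rw [inv_pow]
      exact inv_anti₀ (by positivity) (by nlinarith)
    nlinarith [mul_le_mul_of_nonneg_right h4 (sq_nonneg c), mul_pow C₀⁻¹ c 2]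
  have hcs : (c ^ 2) ^ (s / 2) = c ^ s := by
    rw [← Real.rpow_natCast, ← Real.rpow_mul hc0.le]
    congr 1
    push_cast
    ring
  rcases le_total 0 s with hs | hs
  · rw [abs_of_nonneg hs, ← hcs, ← Real.mul_rpow (by positivity) (by positivity)]
    exact Real.rpow_le_rpow (by positivity) hup (by positivity)
  · have h5 : A ^ (|s| / 2) = (A⁻¹) ^ (s / 2) := by
      rw [Real.inv_rpow (by positivity), ← Real.rpow_neg (by positivity), abs_of_nonpos hs]
      congr 1
      ring
    rw [h5, ← hcs, ← Real.mul_rpow (by positivity) (by positivity)]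
    exact Real.rpow_le_rpow_of_nonpos (by positivity) hlow (by linarith)

lemma HormClass.exists_bound_dyadic {n : ℕ} {m δ : ℝ} {a : Rn n → Rn n → ℂ}
    (ha : HormClass m 0 δ a) {C₀ : ℝ} (hC₀ : 1 < C₀) (N : ℕ) :
    ∃ P : ℝ, 0 ≤ P ∧ ∀ c : ℝ, 1 ≤ c → ∀ k ≤ N, ∀ l ≤ N, ∀ x ξ : Rn n, C₀⁻¹ * c ≤ ‖ξ‖ →
      ‖ξ‖ ≤ 2 * C₀ * c →
      ‖iteratedFDeriv ℝ l (fun x => iteratedFDeriv ℝ k (a x) ξ) x‖ ≤ P * c ^ m * (c ^ δ) ^ l := by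
  choose C hC h using ha.2
  set P : ℕ → ℕ → ℝ := fun k l => C k l * (1 + 4 * C₀ ^ 2) ^ (|m - 0 * k + δ * l| / 2)
  have hP : ∀ k l, 0 ≤ P k l := fun k l => mul_nonneg (hC k l).le (by positivity)
  refine ⟨∑ k ∈ Finset.range (N + 1), ∑ l ∈ Finset.range (N + 1), P k l,
    Finset.sum_nonneg fun k _ => Finset.sum_nonneg fun l _ => hP k l, ?_⟩
  intro c hc k hk l hl x ξ h1 h2
  have hc0 : 0 < c := by linarith
  have h3 : P k l ≤ ∑ k ∈ Finset.range (N + 1), ∑ l ∈ Finset.range (N + 1), P k l :=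
    (Finset.single_le_sum (f := fun l => P k l) (fun l _ => hP k l)
      (Finset.mem_range.2 (by omega))).trans
    (Finset.single_le_sum (f := fun k => ∑ l ∈ Finset.range (N + 1), P k l)
      (fun k _ => Finset.sum_nonneg fun l _ => hP k l) (Finset.mem_range.2 (by omega)))
  have h4 : c ^ (m - 0 * k + δ * l) = c ^ m * (c ^ δ) ^ l := by
    rw [zero_mul, sub_zero, Real.rpow_add hc0, Real.rpow_mul hc0.le, Real.rpow_natCast]
  calc _ ≤ C k l * (1 + ‖ξ‖ ^ 2) ^ ((m - 0 * k + δ * l) / 2) := h k l x ξ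
    _ ≤ C k l * ((1 + 4 * C₀ ^ 2) ^ (|m - 0 * k + δ * l| / 2) * c ^ (m - 0 * k + δ * l)) :=
        mul_le_mul_of_nonneg_left (one_add_sq_rpow_le hC₀ hc h1 h2) (hC k l).le
    _ = P k l * (c ^ m * (c ^ δ) ^ l) := by rw [h4, ← mul_assoc]
    _ ≤ (∑ k ∈ Finset.range (N + 1), ∑ l ∈ Finset.range (N + 1), P k l) *
          (c ^ m * (c ^ δ) ^ l) := mul_le_mul_of_nonneg_right h3 (by positivity)
    _ = _ := (mul_assoc _ _ _).symm

lemma cube_subset_closedBall {n : ℕ} (hn : 1 ≤ n) (x₀ : Rn n) {l : ℝ} (hl0 : 0 < l) (hl : l < 1) :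
    cube x₀ l ⊆ Metric.closedBall x₀ (n : ℝ) := by
  intro x hx
  have hn0 : (1 : ℝ) ≤ n := by exact_mod_cast hn
  rw [mem_closedBall_iff_norm, EuclideanSpace.norm_eq]
  refine Real.sqrt_le_iff.2 ⟨by positivity, ?_⟩
  calc ∑ i, ‖(x - x₀) i‖ ^ 2 ≤ ∑ _i : Fin n, (1 : ℝ) := by
        refine Finset.sum_le_sum fun i _ => pow_le_one₀ (norm_nonneg _) ?_
        rw [PiLp.sub_apply, Real.norm_eq_abs]
        linarith [hx i]
    _ = n := by simp
    _ ≤ (n : ℝ) ^ 2 := by nlinarith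

lemma isClosed_cube {n : ℕ} (x₀ : Rn n) (l : ℝ) : IsClosed (cube x₀ l) := by
  simp only [cube, Set.ofPred_forall]
  exact isClosed_iInter fun i => isClosed_le (by fun_prop) continuous_const

lemma volume_cube {n : ℕ} (x₀ : Rn n) {l : ℝ} (hl : 0 ≤ l) :
    volume (cube x₀ l) = ENNReal.ofReal (l ^ n) := by
  have h1 : cube x₀ l = WithLp.ofLp ⁻¹'
      Set.Icc (fun i => x₀ i - l / 2) (fun i => x₀ i + l / 2) := by
    ext x
    simp only [cube, Set.mem_ofPred_eq, Set.mem_preimage, Set.mem_Icc, Pi.le_def, ← forall_and,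
      abs_le]
    refine forall_congr' fun i => ?_
    constructor <;> rintro ⟨h1, h2⟩ <;> constructor <;> linarith
  rw [h1, (PiLp.volume_preserving_ofLp (Fin n)).measure_preimage
    measurableSet_Icc.nullMeasurableSet, Real.volume_Icc_pi]
  simp [ENNReal.ofReal_pow hl]

lemma waveConst_dyadic_eq {n : ℕ} {δ c C₀ : ℝ} (hc : 0 < c) (hC₀ : 0 ≤ C₀) (x₀ : Rn n)
    (r B P : ℝ) :
    waveConst n x₀ r (2 * C₀ * c) B (P * c ^ (-(n : ℝ) - ((n : ℝ) / 2) * δ)) (c ^ δ) =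
      waveConst n 0 r (2 * C₀) B P 1 * (c ^ n)⁻¹ := by
  have h : c ^ (-(n : ℝ) - ((n : ℝ) / 2) * δ) * c ^ (-(n : ℝ) - ((n : ℝ) / 2) * δ) *
      (c ^ δ) ^ n * c ^ n = (c ^ n)⁻¹ := by
    rw [← Real.rpow_natCast (c ^ δ) n, ← Real.rpow_mul hc.le, ← Real.rpow_natCast c n,
      ← Real.rpow_neg hc.le, ← Real.rpow_add hc, ← Real.rpow_add hc, ← Real.rpow_add hc]
    congr 1
    ring
  have h1 : volume.real (Metric.closedBall (0 : Rn n) (2 * C₀ * c)) =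
      c ^ n * volume.real (Metric.closedBall (0 : Rn n) (2 * C₀)) := by
    rw [Measure.addHaar_real_closedBall _ _ (by positivity),
      Measure.addHaar_real_closedBall _ _ (by positivity), finrank_euclideanSpace, Fintype.card_fin,
      mul_pow _ c]
    ring
  rw [waveConst, waveConst, ← h, h1, Measure.addHaar_real_closedBall_center volume x₀]
  ring

lemma waveConst_nonneg {n : ℕ} (x₀ : Rn n) (r R : ℝ) {B P H : ℝ} (hB : 0 ≤ B) (hH : 0 ≤ H) :
    0 ≤ waveConst n x₀ r R B P H := by
  have h : 0 ≤ ∫ ξ : Rn n, ((1 + ‖ξ‖) ^ (n + 1))⁻¹ := integral_nonneg fun _ => by positivity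
  have := mul_self_nonneg P
  rw [waveConst]
  positivity

lemma Kj_eq_mul_integral_wave {n : ℕ} (a : Rn n → Rn n → ℂ) (ψ : Rn n → ℝ) (j : ℕ) (x y : Rn n) :
    Kj a ψ j x y = ((((2 * π) ^ n)⁻¹ : ℝ) : ℂ) *
      ∫ ξ, wave (x - y) ξ * (a x ξ * ((ψ ((((2 : ℝ) ^ j)⁻¹) • ξ) : ℝ) : ℂ)) := by
  simp only [Kj, wave, mul_assoc]

lemma norm_Kj_le {n : ℕ} (a : Rn n → Rn n → ℂ) (ψ : Rn n → ℝ) (j : ℕ) (x y : Rn n) :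
    ‖Kj a ψ j x y‖ ≤
      ‖∫ ξ, wave (x - y) ξ * (a x ξ * ((ψ ((((2 : ℝ) ^ j)⁻¹) • ξ) : ℝ) : ℂ))‖ := by
  rw [Kj_eq_mul_integral_wave, norm_mul]
  refine mul_le_of_le_one_left (norm_nonneg _) ?_
  rw [Complex.norm_real, norm_inv, norm_pow]
  refine inv_le_one_of_one_le₀ (one_le_pow₀ ?_)
  rw [Real.norm_of_nonneg (by positivity)]
  linarith [Real.pi_gt_three]

lemma one_add_norm_sub_le {n : ℕ} {x₀ x : Rn n} (hx : x ∈ Metric.closedBall x₀ (n : ℝ))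
    (y : Rn n) :
    1 + ‖x₀ - y‖ ≤ (1 + n) + |⟪(‖x₀ - y‖)⁻¹ • (x₀ - y), x - y⟫_ℝ| := by
  set v := (‖x₀ - y‖)⁻¹ • (x₀ - y) with hv
  have hv1 : ‖v‖ ≤ 1 := by
    rw [hv, norm_smul, norm_inv, norm_norm]
    exact inv_mul_le_one
  have h1 : ⟪v, x - y⟫_ℝ = ⟪v, x - x₀⟫_ℝ + ‖x₀ - y‖ := by
    rw [← sub_add_sub_cancel x x₀ y, inner_add_right, hv, real_inner_smul_left (x₀ - y) (x₀ - y),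
      real_inner_self_eq_norm_mul_norm, ← mul_assoc]
    rcases eq_or_ne ‖x₀ - y‖ 0 with h | h
    · simp [h]
    · rw [inv_mul_cancel₀ h, one_mul]
  have h2 : |⟪v, x - x₀⟫_ℝ| ≤ n := by
    refine (abs_real_inner_le_norm _ _).trans ((mul_le_of_le_one_left (norm_nonneg _) hv1).trans ?_)
    exact mem_closedBall_iff_norm.1 hx
  have h3 := neg_le_of_abs_le h2
  have h4 := le_abs_self ⟪v, x - y⟫_ℝ
  linarith

lemma exists_lintegral_sq_Kj_le {n : ℕ} (hn : 1 ≤ n) {δ : ℝ} (hδ : 0 ≤ δ)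
    {a : Rn n → Rn n → ℂ} (ha : HormClass (-(n : ℝ) - ((n : ℝ) / 2) * δ) 0 δ a)
    {C₀ : ℝ} (hC₀ : 1 < C₀) {ψ : Rn n → ℝ} (hψ : LPcut C₀ ψ) :
    ∃ C : ℝ, 0 ≤ C ∧ ∀ l : ℝ, 0 < l → l < 1 → ∀ (j : ℕ) (x₀ y : Rn n),
      ∫⁻ x in cube x₀ l, ‖Kj a ψ j x y‖ₑ ^ 2 ≤
        ENNReal.ofReal (C * (((2 : ℝ) ^ j) ^ n)⁻¹ * ((1 + ‖x₀ - y‖) ^ (2 * (n + 1)))⁻¹) := by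
  obtain ⟨B, hB, hχ⟩ := exists_spatial_cutoff hn
  obtain ⟨D, hD, hφ⟩ := exists_frequency_cutoff_bound hψ (n + 1)
  obtain ⟨P, hP, hsym⟩ := ha.exists_bound_dyadic hC₀ (n + 1)
  have hW := waveConst_nonneg (n := n) 0 (2 * n) (2 * C₀) (P := P * D) hB zero_le_one
  set W := waveConst n 0 (2 * n) (2 * C₀) B (P * D) 1 with hWdef
  refine ⟨(4 ^ (n + 1) * (1 + n) ^ (2 * (n + 1)) + 4 ^ (n + 1) * 4 ^ (n + 1)) * W,
    by positivity, fun l hl0 hl1 j x₀ y => ?_⟩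
  set c : ℝ := (2 : ℝ) ^ j with hcdef
  have hc : 1 ≤ c := one_le_pow₀ (by norm_num)
  have hc0 : 0 < c := by linarith
  obtain ⟨χ, hχ1, hχ2, hχ3, hχ4, hχ5⟩ := hχ x₀
  set v := (‖x₀ - y‖)⁻¹ • (x₀ - y) with hv
  have hv1 : ‖v‖ ≤ 1 := by
    rw [hv, norm_smul, norm_inv, norm_norm]
    exact inv_mul_le_one
  set φ : Rn n → ℂ := fun ξ => ((ψ (c⁻¹ • ξ) : ℝ) : ℂ) with hφdef
  set m := -(n : ℝ) - ((n : ℝ) / 2) * δ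
  have hφs : tsupport φ ⊆ {ξ | C₀⁻¹ * c ≤ ‖ξ‖ ∧ ‖ξ‖ ≤ 2 * C₀ * c} := by
    intro ξ hξ
    have h1 : ξ ∈ tsupport (ψ ∘ fun ξ => c⁻¹ • ξ) :=
      closure_mono (fun ξ h => by simpa [hφdef] using h) hξ
    have h2 := hψ.2.2.2.2 (tsupport_comp_subset_preimage ψ
      (by fun_prop : Continuous fun ξ : Rn n => c⁻¹ • ξ) h1)
    simp only [Set.mem_ofPred_eq, norm_smul, norm_inv, Real.norm_of_nonneg hc0.le] at h2 ⊢
    rwa [← div_eq_inv_mul, le_div_iff₀ hc0, div_le_iff₀ hc0] at h2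
  have main := fun p hp => lintegral_sq_inner_pow_mul_integral_wave_le (y := y)
    (P := P * c ^ m) (H := c ^ δ) (R := 2 * C₀ * c) hχ1 hχ2 hχ3
    (fun x hx => hχ4 x (cube_subset_closedBall hn x₀ hl0 hl1 hx)) (isClosed_cube x₀ l).measurableSet
    (fun ξ hξ => by simpa using hξ.2) hB (by positivity) (Real.one_le_rpow hc hδ) hD hv1 hχ5 ha.1 p
    0 φ (Complex.ofRealCLM.contDiff.comp (hψ.1.comp (contDiff_const_smul _))) hφs
    (fun q hq => hφ j q (hq.trans hp))
    (fun k hk l hl x ξ hξ => hsym c hc k (by omega) l hl x ξ hξ.1 hξ.2)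
  have hPD : P * c ^ m * D = P * D * c ^ m := by ring
  simp only [iteratedFDeriv_zero_apply, hPD, m, waveConst_dyadic_eq hc0 (by linarith : 0 ≤ C₀),
    ← hWdef] at main
  set I : Rn n → ℂ := fun x => ∫ ξ, wave (x - y) ξ * (a x ξ * φ ξ) with hI
  have m0 := main 0 (by omega)
  have m1 := main (n + 1) le_rfl
  simp only [pow_zero, one_mul] at m0
  set T := 1 + ‖x₀ - y‖ with hT
  have hT0 : 0 < T := by positivity
  have hpt : ∀ x ∈ cube x₀ l, ENNReal.ofReal (T ^ (2 * (n + 1))) * ‖Kj a ψ j x y‖ₑ ^ 2 ≤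
      ENNReal.ofReal (4 ^ (n + 1) * (1 + n) ^ (2 * (n + 1))) * ‖I x‖ₑ ^ 2 +
        ENNReal.ofReal (4 ^ (n + 1)) * ‖((⟪v, x - y⟫_ℝ : ℝ) : ℂ) ^ (n + 1) * I x‖ₑ ^ 2 := by
    intro x hx
    have h1 : T ≤ (1 + n) + |⟪v, x - y⟫_ℝ| :=
      one_add_norm_sub_le (cube_subset_closedBall hn x₀ hl0 hl1 hx) y
    have h2 : T ^ (2 * (n + 1)) ≤
        4 ^ (n + 1) * ((1 + n) ^ (2 * (n + 1)) + |⟪v, x - y⟫_ℝ| ^ (2 * (n + 1))) := by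
      calc T ^ (2 * (n + 1)) ≤ ((1 + n) + |⟪v, x - y⟫_ℝ|) ^ (2 * (n + 1)) := by gcongr
        _ ≤ 2 ^ (2 * (n + 1) - 1) *
            ((1 + n) ^ (2 * (n + 1)) + |⟪v, x - y⟫_ℝ| ^ (2 * (n + 1))) :=
          add_pow_le (by positivity) (abs_nonneg _) _
        _ ≤ 2 ^ (2 * (n + 1)) *
            ((1 + n) ^ (2 * (n + 1)) + |⟪v, x - y⟫_ℝ| ^ (2 * (n + 1))) := by
          gcongr
          · norm_num
          · omega
        _ = _ := by
          rw [pow_mul 2]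
          norm_num
    have h3 : T ^ (2 * (n + 1)) * ‖Kj a ψ j x y‖ ^ 2 ≤
        4 ^ (n + 1) * (1 + n) ^ (2 * (n + 1)) * ‖I x‖ ^ 2 +
          4 ^ (n + 1) * ‖((⟪v, x - y⟫_ℝ : ℝ) : ℂ) ^ (n + 1) * I x‖ ^ 2 := by
      calc _ ≤ 4 ^ (n + 1) * ((1 + n) ^ (2 * (n + 1)) + |⟪v, x - y⟫_ℝ| ^ (2 * (n + 1))) *
            ‖I x‖ ^ 2 := by
            gcongr
            exact norm_Kj_le a ψ j x y
        _ = _ := by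
            rw [norm_mul, norm_pow, Complex.norm_real, Real.norm_eq_abs]
            ring
    have h4 := ENNReal.ofReal_le_ofReal h3
    rw [ENNReal.ofReal_add (by positivity) (by positivity), ENNReal.ofReal_mul (by positivity),
      ENNReal.ofReal_mul (p := 4 ^ (n + 1) * (1 + n) ^ (2 * (n + 1))) (by positivity),
      ENNReal.ofReal_mul (p := 4 ^ (n + 1)) (q := ‖_ * I x‖ ^ 2) (by positivity)] at h4
    simpa only [ENNReal.ofReal_pow (norm_nonneg _), ofReal_norm] using h4
  have hIm : Measurable fun x => ‖I x‖ₑ ^ 2 := by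
    have h1 := (measurable_integral_wave (g := fun x ξ => a x ξ * φ ξ)
      (ha.1.continuous.mul ((Complex.continuous_ofReal.comp
        (hψ.1.continuous.comp (by fun_prop))).comp continuous_snd))).comp
      (measurable_id.prodMk (measurable_const (a := y)))
    exact h1.enorm.pow_const 2
  have hTp : 0 < T ^ (2 * (n + 1)) := by positivity
  rw [← div_eq_mul_inv, ENNReal.ofReal_div_of_pos hTp, ENNReal.le_div_iff_mul_le
    (Or.inl (ENNReal.ofReal_pos.2 hTp).ne') (Or.inl ENNReal.ofReal_ne_top), mul_comm,
    ← lintegral_const_mul' _ _ ENNReal.ofReal_ne_top]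
  calc _ ≤ ∫⁻ x in cube x₀ l,
        (ENNReal.ofReal (4 ^ (n + 1) * (1 + n) ^ (2 * (n + 1))) * ‖I x‖ₑ ^ 2 +
          ENNReal.ofReal (4 ^ (n + 1)) *
            ‖((⟪v, x - y⟫_ℝ : ℝ) : ℂ) ^ (n + 1) * I x‖ₑ ^ 2) :=
        setLIntegral_mono' (isClosed_cube x₀ l).measurableSet hpt
    _ ≤ ENNReal.ofReal (4 ^ (n + 1) * (1 + n) ^ (2 * (n + 1))) * ENNReal.ofReal (W * (c ^ n)⁻¹) +
          ENNReal.ofReal (4 ^ (n + 1)) * (4 ^ (n + 1) * ENNReal.ofReal (W * (c ^ n)⁻¹)) := by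
        rw [lintegral_add_left (hIm.const_mul _), lintegral_const_mul' _ _ ENNReal.ofReal_ne_top,
          lintegral_const_mul' _ _ ENNReal.ofReal_ne_top]
        gcongr
    _ = _ := by
        have h4 : (4 : ℝ≥0∞) ^ (n + 1) = ENNReal.ofReal (4 ^ (n + 1)) := by
          rw [ENNReal.ofReal_pow (by norm_num)]
          norm_num
        rw [h4, ← ENNReal.ofReal_mul (by positivity), ← ENNReal.ofReal_mul (by positivity),
          ← ENNReal.ofReal_mul (by positivity), ← ENNReal.ofReal_add (by positivity)
          (by positivity)]
        congr 1
        ring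

lemma measurable_Kj {n : ℕ} {a : Rn n → Rn n → ℂ} (ha : Continuous (Function.uncurry a))
    {ψ : Rn n → ℝ} (hψ : Continuous ψ) (j : ℕ) :
    Measurable fun p : Rn n × Rn n => Kj a ψ j p.1 p.2 := by
  simp_rw [Kj_eq_mul_integral_wave]
  exact (measurable_integral_wave
    (g := fun x ξ => a x ξ * ((ψ ((((2 : ℝ) ^ j)⁻¹) • ξ) : ℝ) : ℂ))
    (ha.mul ((Complex.continuous_ofReal.comp (hψ.comp (by fun_prop))).comp
      continuous_snd))).const_mul _

/-- The Cauchy–Schwarz inequality on a cube. -/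
lemma lintegral_cube_le_of_lintegral_sq_le {n : ℕ} {x₀ : Rn n} {l : ℝ} (hl : 0 ≤ l)
    {f : Rn n → ℝ≥0∞} (hf : Measurable f) {G : ℝ} (hG : 0 ≤ G)
    (h : ∫⁻ x in cube x₀ l, f x ^ 2 ≤ ENNReal.ofReal G) :
    ∫⁻ x in cube x₀ l, f x ≤ ENNReal.ofReal (√(G * l ^ n)) := by
  have h1 := ENNReal.lintegral_mul_le_Lp_mul_Lq (volume.restrict (cube x₀ l))
    Real.HolderConjugate.two_two hf.aemeasurable (aemeasurable_const (b := (1 : ℝ≥0∞)))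
  simp only [Pi.mul_apply, mul_one, ENNReal.rpow_two, one_pow, lintegral_one,
    Measure.restrict_apply_univ, volume_cube x₀ hl] at h1
  refine h1.trans ?_
  rw [Real.sqrt_eq_rpow, Real.mul_rpow hG (by positivity), ENNReal.ofReal_mul (by positivity),
    ← ENNReal.ofReal_rpow_of_nonneg hG (by norm_num),
    ← ENNReal.ofReal_rpow_of_nonneg (by positivity) (by norm_num)]
  gcongr

lemma lintegral_cube_le_mul_mHL {n : ℕ} (u : Rn n → ℂ) (x₀ : Rn n) {l : ℝ} (hl : 0 < l) :
    ∫⁻ y in cube x₀ l, ‖u y‖ₑ ≤ ENNReal.ofReal (l ^ n) * mHL u x₀ := by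
  have h0 : ENNReal.ofReal (l ^ n) ≠ 0 := (ENNReal.ofReal_pos.2 (by positivity)).ne'
  rw [mul_comm, ← ENNReal.div_le_iff_le_mul (Or.inl h0) (Or.inl ENNReal.ofReal_ne_top), mHL]
  have hx : x₀ ∈ cube x₀ l := fun i => by
    rw [sub_self, abs_zero]
    positivity
  exact le_iSup₂_of_le x₀ l (le_iSup₂_of_le hl hx le_rfl)

/-- An integral against a weight decaying like `|x₀ - y|^{-n-1}` is controlled by the maximal
function. -/
lemma lintegral_decay_mul_le_mHL {n : ℕ} {u : Rn n → ℂ} (hu : Measurable u) (x₀ : Rn n) :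
    ∫⁻ y, ENNReal.ofReal ((1 + ‖x₀ - y‖) ^ (n + 1))⁻¹ * ‖u y‖ₑ ≤
      ENNReal.ofReal (4 ^ n * 2) * mHL u x₀ := by
  let F : ℕ → Rn n → ℝ≥0∞ := fun k => (cube x₀ (2 ^ (k + 2))).indicator
    fun y => ENNReal.ofReal (((2 : ℝ) ^ k) ^ (n + 1))⁻¹ * ‖u y‖ₑ
  have hpt : ∀ y, ENNReal.ofReal ((1 + ‖x₀ - y‖) ^ (n + 1))⁻¹ * ‖u y‖ₑ ≤ ∑' k, F k y := by
    intro y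
    obtain ⟨k, hk1, hk2⟩ := exists_nat_pow_near (x := 1 + ‖x₀ - y‖) (y := (2 : ℝ))
      (by linarith [norm_nonneg (x₀ - y)]) (by norm_num)
    have hy : y ∈ cube x₀ (2 ^ (k + 2)) := by
      intro i
      have h1 := PiLp.norm_apply_le (x₀ - y) i
      rw [PiLp.sub_apply, Real.norm_eq_abs, abs_sub_comm] at h1
      rw [pow_succ] at hk2 ⊢
      rw [pow_succ]
      linarith
    refine le_trans ?_ (ENNReal.le_tsum k)
    simp only [F, Set.indicator_of_mem hy]
    gcongr
  have hint : ∀ k, ∫⁻ y, F k y ≤ ENNReal.ofReal (4 ^ n * (1 / 2) ^ k) * mHL u x₀ := by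
    intro k
    simp only [F]
    rw [lintegral_indicator (isClosed_cube _ _).measurableSet,
      lintegral_const_mul' _ _ ENNReal.ofReal_ne_top]
    calc _ ≤ ENNReal.ofReal (((2 : ℝ) ^ k) ^ (n + 1))⁻¹ *
          (ENNReal.ofReal ((2 ^ (k + 2)) ^ n) * mHL u x₀) := by
          gcongr
          exact lintegral_cube_le_mul_mHL u x₀ (by positivity)
      _ = _ := by
          rw [← mul_assoc, ← ENNReal.ofReal_mul (by positivity)]
          congr 2
          have h4 : (4 : ℝ) = 2 ^ 2 := by norm_num
          rw [pow_add 2 k 2, mul_pow, ← h4, pow_succ, one_div, inv_pow]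
          field_simp
  calc _ ≤ ∫⁻ y, ∑' k, F k y := lintegral_mono hpt
    _ = ∑' k, ∫⁻ y, F k y := lintegral_tsum fun k =>
        ((hu.enorm.const_mul _).indicator (isClosed_cube _ _).measurableSet).aemeasurable
    _ ≤ ∑' k : ℕ, ENNReal.ofReal (4 ^ n * (1 / 2) ^ k) * mHL u x₀ := ENNReal.tsum_le_tsum hint
    _ = _ := by
        rw [ENNReal.tsum_mul_right, ← ENNReal.ofReal_tsum_of_nonneg (fun k => by positivity)
          (summable_geometric_two.mul_left _), tsum_mul_left, tsum_geometric_two]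

lemma lintegral_Tj_le {n : ℕ} {a : Rn n → Rn n → ℂ} (ha : Continuous (Function.uncurry a))
    {ψ : Rn n → ℝ} (hψ : Continuous ψ) (j : ℕ) {u : Rn n → ℂ} (hu : Measurable u)
    (S : Set (Rn n)) :
    ∫⁻ x in S, ‖Tj a ψ j u x‖ₑ ≤ ∫⁻ y, (∫⁻ x in S, ‖Kj a ψ j x y‖ₑ) * ‖u y‖ₑ := by
  have hK := measurable_Kj ha hψ j
  calc _ ≤ ∫⁻ x in S, ∫⁻ y, ‖Kj a ψ j x y‖ₑ * ‖u y‖ₑ := by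
        refine lintegral_mono fun x => (enorm_integral_le_lintegral_enorm _).trans_eq ?_
        simp only [enorm_mul]
    _ = ∫⁻ y, ∫⁻ x in S, ‖Kj a ψ j x y‖ₑ * ‖u y‖ₑ :=
        lintegral_lintegral_swap
          (hK.enorm.mul (hu.comp measurable_snd).enorm).aemeasurable
    _ = _ := by
        refine lintegral_congr fun y => ?_
        rw [lintegral_mul_const' _ _ enorm_ne_top]

/-- If `a ∈ S^{-n-(n/2)δ}_{0,δ}` with `0 ≤ δ < 1`, then for `0 < l < 1` and
`j ≥ 1` with `2^j ≥ l⁻¹`: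
`|Q(x₀,l)|⁻¹ ∫_{Q(x₀,l)} |T_j u| dx ≤ C 2^{-jn/2} l^{-n/2} Mu(x₀)`. -/
theorem stmt10 (n : ℕ) (hn : 1 ≤ n) (δ : ℝ) (hδ0 : 0 ≤ δ) (hδ1 : δ < 1)
    (a : Rn n → Rn n → ℂ) (ha : HormClass (-(n : ℝ) - ((n : ℝ) / 2) * δ) 0 δ a)
    (C₀ : ℝ) (hC₀ : 1 < C₀) (ψ : Rn n → ℝ) (hψ : LPcut C₀ ψ) :
    ∃ C : ℝ, 0 < C ∧ ∀ l : ℝ, 0 < l → l < 1 → ∀ j : ℕ, 1 ≤ j → l⁻¹ ≤ (2 : ℝ) ^ j →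
      ∀ x₀ : Rn n, ∀ u : SchwartzMap (Rn n) ℂ,
        (∫⁻ x in cube x₀ l, (‖Tj a ψ j (⇑u) x‖₊ : ℝ≥0∞)) / ENNReal.ofReal (l ^ n) ≤
          ENNReal.ofReal (C * (2 : ℝ) ^ (-((j : ℝ) * n) / 2) * l ^ (-(n : ℝ) / 2)) *
            mHL (⇑u) x₀ := by
  obtain ⟨C, hC, hK⟩ := exists_lintegral_sq_Kj_le hn hδ0 ha hC₀ hψ
  refine ⟨(√C + 1) * (4 ^ n * 2), by positivity, fun l hl0 hl1 j _ _ x₀ u => ?_⟩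
  have hu : Measurable (⇑u) := u.continuous.measurable
  set c : ℝ := (2 : ℝ) ^ j with hc
  have hc0 : 0 < c := by positivity
  set E : ℝ := √(C * (c ^ n)⁻¹ * l ^ n) with hE
  have hKy : ∀ y, ∫⁻ x in cube x₀ l, ‖Kj a ψ j x y‖ₑ ≤
      ENNReal.ofReal E * ENNReal.ofReal ((1 + ‖x₀ - y‖) ^ (n + 1))⁻¹ := by
    intro y
    have h1 := lintegral_cube_le_of_lintegral_sq_le hl0.le
      (((measurable_Kj ha.1.continuous hψ.1.continuous j).comp
        (measurable_id.prodMk (measurable_const (a := y)))).enorm) (by positivity)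
      (hK l hl0 hl1 j x₀ y)
    refine h1.trans_eq ?_
    rw [← ENNReal.ofReal_mul (by positivity), mul_right_comm, Real.sqrt_mul (by positivity),
      mul_comm 2, pow_mul, Real.sqrt_inv, Real.sqrt_sq (by positivity)]
  have hT : ∫⁻ x in cube x₀ l, ‖Tj a ψ j u x‖ₑ ≤
      ENNReal.ofReal (E * (4 ^ n * 2)) * mHL u x₀ := by
    calc _ ≤ ∫⁻ y, (∫⁻ x in cube x₀ l, ‖Kj a ψ j x y‖ₑ) * ‖u y‖ₑ :=
          lintegral_Tj_le ha.1.continuous hψ.1.continuous j hu _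
      _ ≤ ∫⁻ y, ENNReal.ofReal E *
            (ENNReal.ofReal ((1 + ‖x₀ - y‖) ^ (n + 1))⁻¹ * ‖u y‖ₑ) := by
          refine lintegral_mono fun y => ?_
          rw [← mul_assoc]
          exact mul_le_mul_left (hKy y) _
      _ ≤ ENNReal.ofReal E * (ENNReal.ofReal (4 ^ n * 2) * mHL u x₀) := by
          rw [lintegral_const_mul' _ _ ENNReal.ofReal_ne_top]
          gcongr
          exact lintegral_decay_mul_le_mHL hu x₀
      _ = _ := by rw [← mul_assoc, ← ENNReal.ofReal_mul (by positivity)]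
  have hln : 0 < l ^ n := by positivity
  have hEle : E ≤ (√C + 1) * (2 : ℝ) ^ (-((j : ℝ) * n) / 2) * l ^ (-(n : ℝ) / 2) * l ^ n := by
    have h1 : √((c ^ n)⁻¹) = (2 : ℝ) ^ (-((j : ℝ) * n) / 2) := by
      rw [hc, ← pow_mul, Real.sqrt_eq_rpow, ← Real.rpow_natCast, ← Real.rpow_neg (by norm_num),
        ← Real.rpow_mul (by norm_num)]
      congr 1
      push_cast
      ring
    have h2 : √(l ^ n) = l ^ (-(n : ℝ) / 2) * l ^ n := by
      rw [Real.sqrt_eq_rpow, ← Real.rpow_natCast, ← Real.rpow_mul hl0.le, ← Real.rpow_add hl0]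
      congr 1
      ring
    rw [hE, Real.sqrt_mul (by positivity), Real.sqrt_mul hC, h1, h2, ← mul_assoc]
    gcongr
    linarith
  rw [ENNReal.div_le_iff_le_mul (Or.inl (ENNReal.ofReal_pos.2 hln).ne')
    (Or.inl ENNReal.ofReal_ne_top)]
  refine hT.trans ?_
  rw [mul_right_comm, ← ENNReal.ofReal_mul (by positivity)]
  refine mul_le_mul_left (ENNReal.ofReal_le_ofReal ?_) _
  calc E * (4 ^ n * 2) ≤ (√C + 1) * (2 : ℝ) ^ (-((j : ℝ) * n) / 2) * l ^ (-(n : ℝ) / 2) * l ^ n *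
        (4 ^ n * 2) := by gcongr
    _ = _ := by ring
end
end
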